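/- arXiv:1505.04040 — 4 statements merged into one kernel-verified Lean document; each statement's English description precedes it below -/
import Mathlib

section
/- For p, q ≥ 1 with (p,q) ≠ (1,1) and τ in the upper half-plane, G̃_{2p,2q}(τ) equals G_{2(p+q)}(τ) + Σ_{l₁+l₂=p+q, l₁,l₂≥1} [ (2ζ(2l₂) binom(2l₂-1, 2q-1)/τ^{2l₂}) G_{2l₁}(τ) + (2ζ(2l₁) binom(2l₁-1, 2p-1)/τ^{2l₁}) G_{2l₂}(τ) ] + (4/τ^{2(p+q)})[ ζ(2p)ζ(2q) - ζ(2(p+q))/2 - Σ_{l₁+l₂=p+q, l₁,l₂≥1} ζ(2l₁)ζ(2l₂)( binom(2l₂-1,2q-1) + binom(2l₁-1,2p-1) ) ]. -/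
/-- The Eisenstein series `G_k(τ)` (iterated summation, inner over `n`). -/
noncomputable def G (k : ℕ) (τ : ℂ) : ℂ :=
  ∑' m : ℤ, ∑' n : ℤ, if m = 0 ∧ n = 0 then 0 else 1 / ((m : ℂ) + n * τ) ^ k

/-- The double Eisenstein-type series `G̃_{2p,2q}(τ)`. -/
noncomputable def tildeG (p q : ℕ) (τ : ℂ) : ℂ :=
  ∑' m : ℤ, ∑' n₁ : ℤ, ∑' n₂ : ℤ,
    if (m = 0 ∧ n₁ = 0) ∨ (m = 0 ∧ n₂ = 0) then 0
    else 1 / (((m : ℂ) + n₁ * τ) ^ (2 * p) * ((m : ℂ) + n₂ * τ) ^ (2 * q))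


lemma pf_rec (F : ℕ → ℕ → ℂ) (X Y H : ℂ) (hXY : X * Y = H * (Y - X))
    (h0 : ∀ b, F 0 (b+1) = Y ^ (b+1)) (h1 : ∀ a, F (a+1) 0 = X ^ (a+1))
    (hs : ∀ a b, F (a+1) (b+1) = H * (F a (b+1) - F (a+1) b)) :
    ∀ a b, F (a+1) (b+1) = X ^ (a+1) * Y ^ (b+1) := by
  intro a
  induction a with
  | zero =>
    intro b
    induction b with
    | zero => rw [hs, h0, h1]; simp; exact hXY.symm
    | succ b ih => rw [hs, h0, ih]; linear_combination (-Y^(b+1)) * hXY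
  | succ a iha =>
    intro b
    induction b with
    | zero => rw [hs, iha, h1]; linear_combination (-X^(a+1)) * hXY
    | succ b ih => rw [hs, iha, ih]; linear_combination (-X^(a+1)*Y^(b+1)) * hXY

lemma pf (X Y H : ℂ) (hXY : X * Y = H * (Y - X)) (a b : ℕ) :
    X ^ (a+1) * Y ^ (b+1) =
      (∑ j ∈ Finset.range (a+1), (-1) ^ (b+1) * (Nat.multichoose (b+1) j : ℂ) * H ^ (b+1+j) * X ^ (a+1-j))
      + ∑ j ∈ Finset.range (b+1), (-1) ^ j * (Nat.multichoose (a+1) j : ℂ) * H ^ (a+1+j) * Y ^ (b+1-j) := by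
  symm
  refine pf_rec (fun a b => (∑ j ∈ Finset.range a, (-1) ^ b * (Nat.multichoose b j : ℂ) * H ^ (b+j) * X ^ (a-j))
      + ∑ j ∈ Finset.range b, (-1) ^ j * (Nat.multichoose a j : ℂ) * H ^ (a+j) * Y ^ (b-j))
    X Y H hXY ?_ ?_ ?_ a b
  · intro b
    simp [Finset.sum_range_succ', Nat.multichoose_zero_right]
  · intro a
    simp [Finset.sum_range_succ', Nat.multichoose_zero_right]
  · intro a b
    have e1 : (∑ j ∈ Finset.range (a+1), (-1) ^ (b+1) * (Nat.multichoose (b+1) j : ℂ) * H ^ (b+1+j) * X ^ (a+1-j))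
      = H * ((∑ j ∈ Finset.range a, (-1) ^ (b+1) * (Nat.multichoose (b+1) j : ℂ) * H ^ (b+1+j) * X ^ (a-j))
        - ∑ j ∈ Finset.range (a+1), (-1) ^ b * (Nat.multichoose b j : ℂ) * H ^ (b+j) * X ^ (a+1-j)) := by
      rw [Finset.sum_range_succ', Finset.sum_range_succ' _ a, ← sub_sub, ← Finset.sum_sub_distrib,
        mul_sub, Finset.mul_sum, sub_eq_add_neg]
      congr 1
      · apply Finset.sum_congr rfl
        intro j _
        rw [Nat.multichoose_succ_succ, Nat.add_sub_add_right]
        push_cast; ring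
      · simp [Nat.multichoose_zero_right]; ring
    have e2 : (∑ j ∈ Finset.range (b+1), (-1) ^ j * (Nat.multichoose (a+1) j : ℂ) * H ^ (a+1+j) * Y ^ (b+1-j))
      = H * ((∑ j ∈ Finset.range (b+1), (-1) ^ j * (Nat.multichoose a j : ℂ) * H ^ (a+j) * Y ^ (b+1-j))
        - ∑ j ∈ Finset.range b, (-1) ^ j * (Nat.multichoose (a+1) j : ℂ) * H ^ (a+1+j) * Y ^ (b-j)) := by
      rw [Finset.sum_range_succ', Finset.sum_range_succ' _ b, add_sub_right_comm, ← Finset.sum_sub_distrib,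
        mul_add, Finset.mul_sum]
      congr 1
      · apply Finset.sum_congr rfl
        intro j _
        rw [Nat.multichoose_succ_succ, Nat.add_sub_add_right]
        push_cast; ring
      · simp [Nat.multichoose_zero_right]; ring
    rw [e1, e2]; ring

lemma sum_u (u : ℂ) (k : ℕ) (hk : 2 ≤ k) : Summable (fun n : ℤ => ((u + n)⁻¹) ^ k) := by
  have := EisensteinSeries.linear_right_summable u 1 (k := k) (by exact_mod_cast hk)
  simpa using this

lemma tele1 (u : ℂ) (hu : ∀ n : ℤ, u + n ≠ 0) :
    HasSum (fun n : ℤ => (u + n)⁻¹ - (u + n + 1)⁻¹) 0 := by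
  have hs : Summable (fun n : ℤ => (u + n)⁻¹ - (u + n + 1)⁻¹) := by
    have := EisensteinSeries.summable_linear_right_add_one_mul_linear_right u 1 1
    refine this.congr fun n => ?_
    have h1 := hu n
    have h2 := hu (n+1)
    push_cast at h2
    rw [← add_assoc] at h2
    simp only [Int.cast_one, one_mul]
    field_simp
    ring
  have h2 := hs.hasSum.nat_add_neg_add_one.tendsto_sum_nat
  have h3 : ∀ N : ℕ, ∑ i ∈ Finset.range N, ((u + ((i:ℤ):ℂ))⁻¹ - (u + ((i:ℤ):ℂ) + 1)⁻¹ + ((u + ((-((i:ℤ) + 1) : ℤ):ℂ))⁻¹ - (u + ((-((i:ℤ) + 1) : ℤ):ℂ) + 1)⁻¹)) = (u - N)⁻¹ - (u + N)⁻¹ := by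
    intro N
    induction N with
    | zero => simp
    | succ N ih =>
      rw [Finset.sum_range_succ, ih]
      push_cast
      ring_nf
  simp_rw [h3] at h2
  have h4 : Filter.Tendsto (fun N : ℕ => (u - N)⁻¹ - (u + N)⁻¹) Filter.atTop (nhds 0) := by
    have := (EisensteinSeries.tendsto_zero_inv_linear_sub u 1).sub (EisensteinSeries.tendsto_zero_inv_linear u 1)
    simpa using this
  have := tendsto_nhds_unique h2 h4
  rw [← this]
  exact hs.hasSum

lemma tele (u : ℂ) (hu : ∀ n : ℤ, u + n ≠ 0) (h : ℤ) :
    HasSum (fun n : ℤ => (u + n)⁻¹ - (u + n + h)⁻¹) 0 := by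
  induction h with
  | zero => simp
  | succ i ih =>
    have := ih.add ((Equiv.addRight (i:ℤ)).hasSum_iff.mpr (tele1 u hu))
    rw [add_zero] at this
    convert this using 2
    simp
    ring_nf
  | pred i ih =>
    have := ih.sub ((Equiv.addRight (-(i:ℤ)-1)).hasSum_iff.mpr (tele1 u hu))
    rw [sub_zero] at this
    convert this using 2
    · rfl
    · simp
      ring_nf

/-- the one-variable lattice sum -/
noncomputable def TT (u : ℂ) (k : ℕ) : ℂ := ∑' n : ℤ, ((u + n)⁻¹) ^ k
noncomputable def ZZ (k : ℕ) : ℂ := ∑' n : ℤ, ((n : ℂ)⁻¹) ^ k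

lemma hasSum_TT (u : ℂ) (k : ℕ) (hk : 2 ≤ k) :
    HasSum (fun n : ℤ => ((u + n)⁻¹) ^ k) (TT u k) := (sum_u u k hk).hasSum

lemma hasSum_ZZ (k : ℕ) (hk : 2 ≤ k) :
    HasSum (fun n : ℤ => ((n : ℂ)⁻¹) ^ k) (ZZ k) := by
  simpa [ZZ] using (sum_u 0 k hk).hasSum

lemma ZZ_odd (k : ℕ) (hk : Odd k) : ZZ k = 0 := by
  have h : ZZ k = - ZZ k := by
    unfold ZZ
    rw [← tsum_neg]
    conv_lhs => rw [← (Equiv.neg ℤ).tsum_eq]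
    refine tsum_congr fun n => ?_
    simp [inv_neg, hk.neg_pow]
  linear_combination h / 2

lemma ZZ_even (k : ℕ) (hk : 1 ≤ k) : ZZ (2 * k) = 2 * riemannZeta (2 * k) := by
  have := two_mul_riemannZeta_eq_tsum_int_inv_pow_of_even (k := 2 * k) (by omega) (by simp)
  push_cast at this
  rw [this]
  simp [ZZ]

lemma inner_hasSum (u : ℂ) (hu : ∀ n : ℤ, u + n ≠ 0) (A B : ℕ) (hB : Odd B) (h : ℤ) (hh : h ≠ 0) :
    HasSum (fun n : ℤ => ((u + n)⁻¹) ^ (A+1) * ((u + (n - h : ℤ))⁻¹) ^ (B+1))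
      ((∑ j ∈ Finset.range A, (Nat.multichoose (B+1) j : ℂ) * TT u (A+1-j) * ((h:ℂ)⁻¹) ^ (B+1+j))
      + ∑ j ∈ Finset.range B, (-1) ^ j * (Nat.multichoose (A+1) j : ℂ) * TT u (B+1-j) * ((h:ℂ)⁻¹) ^ (A+1+j)) := by
  have h1 : HasSum (fun n : ℤ => ∑ j ∈ Finset.range A, (Nat.multichoose (B+1) j : ℂ) * ((u + n)⁻¹) ^ (A+1-j) * ((h:ℂ)⁻¹) ^ (B+1+j)) _ :=
    hasSum_sum fun j hj => ((hasSum_TT u (A+1-j) (by have := Finset.mem_range.mp hj; omega)).mul_left _).mul_right _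
  have h2 : HasSum (fun n : ℤ => ∑ j ∈ Finset.range B, (-1) ^ j * (Nat.multichoose (A+1) j : ℂ) * ((u + (n - h : ℤ))⁻¹) ^ (B+1-j) * ((h:ℂ)⁻¹) ^ (A+1+j)) _ :=
    hasSum_sum fun j hj => (((Equiv.subRight h).hasSum_iff.mpr (hasSum_TT u (B+1-j) (by have := Finset.mem_range.mp hj; omega))).mul_left _).mul_right _
  have h3 := (tele u hu (-h)).mul_left ((Nat.multichoose (B+1) A : ℂ) * ((h:ℂ)⁻¹) ^ (B+1+A))
  have h4 := (h1.add h2).add h3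
  rw [mul_zero, add_zero] at h4
  convert h4 using 2 with n
  have hx := hu n
  have hy := hu (n - h)
  have hh' : (h:ℂ) ≠ 0 := by exact_mod_cast hh
  have hmc : (Nat.multichoose (A+1) B) = Nat.multichoose (B+1) A := by
    rw [Nat.multichoose_eq, Nat.multichoose_eq]
    have e1 : A + 1 + B - 1 = A + B := by omega
    have e2 : B + 1 + A - 1 = A + B := by omega
    rw [e1, e2, Nat.choose_symm_add]
  rw [pf _ _ ((h:ℂ)⁻¹) ?_ A B, Finset.sum_range_succ _ A, Finset.sum_range_succ _ B, hmc, hB.neg_one_pow,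
    (hB.add_one).neg_one_pow]
  · simp only [Nat.add_sub_cancel_left, pow_one]
    have e : u + ((n - h : ℤ):ℂ) = u + n + ((-h : ℤ):ℂ) := by push_cast; ring
    rw [e]
    have e3 : A + 1 + B = B + 1 + A := by omega
    rw [e3]
    have s1 : ∀ j, (1:ℂ) * (Nat.multichoose (B+1) j : ℂ) * ((h:ℂ)⁻¹) ^ (B+1+j) * ((u + n)⁻¹) ^ (A+1-j) = (Nat.multichoose (B+1) j : ℂ) * ((u + n)⁻¹) ^ (A+1-j) * ((h:ℂ)⁻¹) ^ (B+1+j) := fun j => by ring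
    have s2 : ∀ j (z : ℂ), (-1:ℂ)^j * (Nat.multichoose (A+1) j : ℂ) * ((h:ℂ)⁻¹) ^ (A+1+j) * z = (-1)^j * (Nat.multichoose (A+1) j : ℂ) * z * ((h:ℂ)⁻¹) ^ (A+1+j) := fun j z => by ring
    simp only [s1, s2]
    ring
  · push_cast at hy ⊢
    field_simp
    ring

lemma prodT (u : ℂ) (hu : ∀ n : ℤ, u + n ≠ 0) (A B : ℕ) (hA : Odd A) (hB : Odd B) :
    TT u (A+1) * TT u (B+1) = TT u (A+1+(B+1)) +
      ((∑ j ∈ Finset.range A, (Nat.multichoose (B+1) j : ℂ) * TT u (A+1-j) * ZZ (B+1+j))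
      + ∑ j ∈ Finset.range B, (-1) ^ j * (Nat.multichoose (A+1) j : ℂ) * TT u (B+1-j) * ZZ (A+1+j)) := by
  have hA1 := hA.pos
  have hB1 := hB.pos
  have sA := (sum_u u (A+1) (by omega)).norm
  have sB := (sum_u u (B+1) (by omega)).norm
  have H : HasSum (fun z : ℤ × ℤ => ((u + z.1)⁻¹) ^ (A+1) * ((u + z.2)⁻¹) ^ (B+1)) (TT u (A+1) * TT u (B+1)) := by
    unfold TT
    rw [tsum_mul_tsum_of_summable_norm sA sB]
    exact (summable_mul_of_summable_norm sA sB).hasSum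
  let e : ℤ × ℤ ≃ ℤ × ℤ := ⟨fun z => (z.2, z.2 - z.1), fun z => (z.1 - z.2, z.1), fun z => by simp, fun z => by simp⟩
  have H2 := e.hasSum_iff.mpr H
  let Q : ℤ → ℂ := fun h => ((∑ j ∈ Finset.range A, (Nat.multichoose (B+1) j : ℂ) * TT u (A+1-j) * ((h:ℂ)⁻¹) ^ (B+1+j))
      + ∑ j ∈ Finset.range B, (-1) ^ j * (Nat.multichoose (A+1) j : ℂ) * TT u (B+1-j) * ((h:ℂ)⁻¹) ^ (A+1+j))
  have Q0 : Q 0 = 0 := by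
    simp only [Q, Int.cast_zero, inv_zero]
    rw [Finset.sum_eq_zero, Finset.sum_eq_zero, add_zero]
    · intro j _; rw [zero_pow (by omega), mul_zero]
    · intro j _; rw [zero_pow (by omega), mul_zero]
  have H3 : HasSum (fun h : ℤ => (if h = 0 then TT u (A+1+(B+1)) else 0) + Q h) (TT u (A+1) * TT u (B+1)) := by
    refine H2.prod_fiberwise fun h => ?_
    by_cases hh : h = 0
    · subst hh
      rw [Q0, if_pos rfl, add_zero]
      convert hasSum_TT u (A+1+(B+1)) (by omega) using 2 with n
      simp [e, pow_add]
    · rw [if_neg hh, zero_add]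
      exact inner_hasSum u hu A B hB h hh
  refine H3.unique ?_
  refine (hasSum_ite_eq _ _).add (HasSum.add ?_ ?_)
  · exact hasSum_sum fun j _ => (hasSum_ZZ _ (by omega)).mul_left _
  · exact hasSum_sum fun j _ => (hasSum_ZZ _ (by omega)).mul_left _

lemma TT_zero (k : ℕ) : TT 0 k = ZZ k := by simp [TT, ZZ]

lemma TT_neg (u : ℂ) (k : ℕ) (hk : Even k) : TT (-u) k = TT u k := by
  unfold TT
  conv_lhs => rw [← (Equiv.neg ℤ).tsum_eq]
  refine tsum_congr fun n => ?_
  have : -u + ((Equiv.neg ℤ n : ℤ) : ℂ) = -(u + n) := by simp; ring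
  rw [this, inv_neg, hk.neg_pow]

lemma sum_evens (f : ℕ → ℂ) (hf : ∀ i, f (2 * i + 1) = 0) (p : ℕ) :
    ∑ j ∈ Finset.range (2 * p + 1), f j = ∑ i ∈ Finset.range (p + 1), f (2 * i) := by
  induction p with
  | zero => simp
  | succ p ih =>
    rw [Finset.sum_range_succ _ (p+1), ← ih, show 2 * (p+1) + 1 = 2*p+1+1+1 by ring,
      Finset.sum_range_succ, Finset.sum_range_succ _ (2*p+1), hf]
    ring_nf

lemma reindex (p q : ℕ) (hq : 1 ≤ q) (F : ℕ → ℂ) :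
    ∑ l ∈ Finset.Ioo 0 (p + q), (Nat.choose (2 * (p + q - l) - 1) (2 * q - 1) : ℂ) * F l
      = ∑ i ∈ Finset.range p, (Nat.multichoose (2 * q) (2 * i) : ℂ) * F (p - i) := by
  have h1 : ∑ l ∈ Finset.Ioc 0 p, (Nat.choose (2 * (p + q - l) - 1) (2 * q - 1) : ℂ) * F l
     = ∑ l ∈ Finset.Ioo 0 (p + q), (Nat.choose (2 * (p + q - l) - 1) (2 * q - 1) : ℂ) * F l := by
    apply Finset.sum_subset
    · intro l hl
      simp only [Finset.mem_Ioc, Finset.mem_Ioo] at *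
      omega
    · intro l hl hl'
      simp only [Finset.mem_Ioc, Finset.mem_Ioo] at *
      rw [Nat.choose_eq_zero_of_lt (by omega)]
      simp
  rw [← h1]
  refine Finset.sum_nbij' (fun l => p - l) (fun i => p - i) ?_ ?_ ?_ ?_ ?_
  · intro l hl; simp only [Finset.mem_Ioc, Finset.mem_range] at *; omega
  · intro l hl; simp only [Finset.mem_Ioc, Finset.mem_range] at *; omega
  · intro l hl; simp only [Finset.mem_Ioc] at *; omega
  · intro l hl; simp only [Finset.mem_range] at *; omega
  · intro l hl
    simp only [Finset.mem_Ioc] at hl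
    rw [Nat.multichoose_eq, show p - (p - l) = l by omega,
      show 2 * (p + q - l) - 1 = 2 * q + 2 * (p - l) - 1 by omega,
      ← Nat.choose_symm_of_eq_add (show 2 * q + 2 * (p - l) - 1 = 2 * (p - l) + (2 * q - 1) by omega)]

lemma reindex' (p q : ℕ) (hp : 1 ≤ p) (F : ℕ → ℂ) :
    ∑ l ∈ Finset.Ioo 0 (p + q), (Nat.choose (2 * l - 1) (2 * p - 1) : ℂ) * F (p + q - l)
      = ∑ i ∈ Finset.range q, (Nat.multichoose (2 * p) (2 * i) : ℂ) * F (q - i) := by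
  rw [← reindex q p hp]
  refine Finset.sum_nbij' (fun l => p + q - l) (fun l => p + q - l) ?_ ?_ ?_ ?_ ?_
  · intro l hl; simp only [Finset.mem_Ioo] at *; omega
  · intro l hl; simp only [Finset.mem_Ioo] at *; omega
  · intro l hl; simp only [Finset.mem_Ioo] at *; omega
  · intro l hl; simp only [Finset.mem_Ioo] at *; omega
  · intro l hl; simp only [Finset.mem_Ioo] at *
    rw [show q + p - (p + q - l) = l by omega]

lemma prodT_even (u : ℂ) (hu : ∀ n : ℤ, u + n ≠ 0) (p q : ℕ) (hp : 1 ≤ p) (hq : 1 ≤ q) :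
    TT u (2 * p) * TT u (2 * q) = TT u (2 * (p + q)) +
      ∑ l ∈ Finset.Ioo 0 (p + q),
        (ZZ (2 * (p + q - l)) * (Nat.choose (2 * (p + q - l) - 1) (2 * q - 1) : ℂ) * TT u (2 * l)
        + ZZ (2 * l) * (Nat.choose (2 * l - 1) (2 * p - 1) : ℂ) * TT u (2 * (p + q - l))) := by
  have h1 := reindex p q hq (fun l => ZZ (2 * (p + q - l)) * TT u (2 * l))
  have h2 := reindex' p q hp (fun l => ZZ (2 * (p + q - l)) * TT u (2 * l))
  have h3 : ∑ l ∈ Finset.Ioo 0 (p + q),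
        (ZZ (2 * (p + q - l)) * (Nat.choose (2 * (p + q - l) - 1) (2 * q - 1) : ℂ) * TT u (2 * l)
        + ZZ (2 * l) * (Nat.choose (2 * l - 1) (2 * p - 1) : ℂ) * TT u (2 * (p + q - l))) =
     ∑ i ∈ Finset.range p, (Nat.multichoose (2 * q) (2 * i) : ℂ) * (ZZ (2 * (p + q - (p - i))) * TT u (2 * (p - i)))
     + ∑ i ∈ Finset.range q, (Nat.multichoose (2 * p) (2 * i) : ℂ) * (ZZ (2 * (p + q - (q - i))) * TT u (2 * (q - i))) := by
    rw [← h1, ← h2, ← Finset.sum_add_distrib]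
    apply Finset.sum_congr rfl
    intro l hl
    simp only [Finset.mem_Ioo] at hl
    rw [show p + q - (p + q - l) = l by omega]
    ring
  rw [h3]
  obtain ⟨p, rfl⟩ : ∃ p', p = p' + 1 := ⟨p - 1, by omega⟩
  obtain ⟨q, rfl⟩ : ∃ q', q = q' + 1 := ⟨q - 1, by omega⟩
  have := prodT u hu (2 * p + 1) (2 * q + 1) (by simp) (by simp)
  rw [show 2 * (p + 1) = 2 * p + 1 + 1 by ring, show 2 * (q + 1) = 2 * q + 1 + 1 by ring,
    show 2 * (p + 1 + (q + 1)) = 2 * p + 1 + 1 + (2 * q + 1 + 1) by ring, this]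
  congr 1
  rw [sum_evens, sum_evens]
  · congr 1
    · apply Finset.sum_congr rfl
      intro i hi
      simp only [Finset.mem_range] at hi
      rw [show 2 * (p + 1 + (q + 1) - (p + 1 - i)) = 2 * q + 1 + 1 + 2 * i by omega,
        show 2 * (p + 1 - i) = 2 * p + 1 + 1 - 2 * i by omega]
      ring
    · apply Finset.sum_congr rfl
      intro i hi
      simp only [Finset.mem_range] at hi
      rw [show 2 * (p + 1 + (q + 1) - (q + 1 - i)) = 2 * p + 1 + 1 + 2 * i by omega,
        show 2 * (q + 1 - i) = 2 * q + 1 + 1 - 2 * i by omega]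
      simp only [even_two, Even.mul_right, Even.neg_pow, one_pow]
      ring
  · intro i
    rw [ZZ_odd, mul_zero]
    exact ⟨p + 1 + i, by ring⟩
  · intro i
    rw [ZZ_odd, mul_zero]
    exact ⟨q + 1 + i, by ring⟩

lemma summable_TT (τ : ℂ) (hτ : 0 < τ.im) (K : ℕ) (hK : 1 ≤ K) :
    Summable (fun m : ℤ => TT (m / τ) (2 * K)) := by
  have hτ0 : τ ≠ 0 := by rintro rfl; simp at hτ
  have him : 0 < (-τ⁻¹).im := by
    rw [Complex.neg_im, Complex.inv_im, neg_div, neg_neg]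
    exact div_pos hτ (Complex.normSq_pos.mpr hτ0)
  have hq := UpperHalfPlane.norm_exp_two_pi_I_lt_one ⟨-τ⁻¹, him⟩
  have hs := (summable_prod_mul_pow (2 * K - 1) hq).prod
  have hpn : Summable (fun m : ℕ+ => TT (((m : ℕ) : ℂ) / τ) (2 * K)) := by
    refine (hs.mul_left ((-2 * Real.pi * Complex.I) ^ (2 * K - 1 + 1) / (2 * K - 1).factorial)).congr fun m => ?_
    have hm : 0 < (((m : ℕ) : ℂ) * (-τ⁻¹)).im := by
      rw [← Complex.ofReal_natCast, Complex.im_ofReal_mul]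
      exact mul_pos (by exact_mod_cast m.pos) him
    have h := EisensteinSeries.qExpansion_identity_pnat (k := 2 * K - 1) (by omega) ⟨_, hm⟩
    rw [show ((m : ℕ) : ℂ) / τ = -(((m : ℕ) : ℂ) * (-τ⁻¹)) by rw [div_eq_mul_inv]; ring, TT_neg _ _ (by simp)]
    simp only [show 2 * K - 1 + 1 = 2 * K by omega] at h ⊢
    have h' : TT (((m : ℕ) : ℂ) * (-τ⁻¹)) (2 * K) = _ := Eq.trans (by simp [TT]) h
    rw [h']
    congr 1
    refine tsum_congr fun n => ?_
    congr 1
    rw [← Complex.exp_nat_mul, ← Complex.exp_nat_mul]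
    congr 1
    push_cast
    ring
  have hn : Summable (fun m : ℕ => TT (((m : ℕ) : ℂ) / τ) (2 * K)) := by
    rw [← summable_nat_add_iff 1]
    exact (summable_pnat_iff_summable_succ (f := fun m : ℕ => TT (((m : ℕ) : ℂ) / τ) (2 * K))).mp hpn
  rw [summable_int_iff_summable_nat_and_neg]
  refine ⟨by simpa using hn, hn.congr fun m => ?_⟩
  rw [← TT_neg _ _ (by simp)]
  congr 1
  push_cast
  ring

lemma inner_eq (τ : ℂ) (hτ : τ ≠ 0) (m : ℤ) (k : ℕ) :
    ∑' n : ℤ, 1 / ((m : ℂ) + n * τ) ^ k = (τ⁻¹) ^ k * TT (m / τ) k := by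
  rw [TT, ← tsum_mul_left]
  refine tsum_congr fun n => ?_
  rw [← mul_pow, one_div, ← inv_pow, ← mul_inv]
  congr 2
  field_simp

lemma G_eq (τ : ℂ) (hτ : τ ≠ 0) (k : ℕ) (hk : k ≠ 0) :
    G k τ = ∑' m : ℤ, (τ⁻¹) ^ k * TT (m / τ) k := by
  unfold G
  refine tsum_congr fun m => ?_
  rw [← inner_eq τ hτ]
  refine tsum_congr fun n => ?_
  split_ifs with h
  · simp [h.1, h.2, hk]
  · rfl

lemma tildeG_eq (τ : ℂ) (hτ : τ ≠ 0) (p q : ℕ) (hp : 1 ≤ p) (hq : 1 ≤ q) :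
    tildeG p q τ = ∑' m : ℤ, ((τ⁻¹) ^ (2*p) * TT (m / τ) (2*p)) * ((τ⁻¹) ^ (2*q) * TT (m / τ) (2*q)) := by
  unfold tildeG
  refine tsum_congr fun m => ?_
  rw [← inner_eq τ hτ, ← inner_eq τ hτ, ← tsum_mul_right]
  refine tsum_congr fun n => ?_
  rw [← tsum_mul_left]
  refine tsum_congr fun n' => ?_
  split_ifs with h
  · rcases h with h | h
    · simp [h.1, h.2, show p ≠ 0 by omega]
    · simp [h.1, h.2, show q ≠ 0 by omega]
  · rw [one_div_mul_one_div]

lemma hasSum_G (τ : ℂ) (hτ : 0 < τ.im) (K : ℕ) (hK : 1 ≤ K) :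
    HasSum (fun m : ℤ => (τ⁻¹) ^ (2 * K) * TT (m / τ) (2 * K)) (G (2 * K) τ) := by
  have hτ0 : τ ≠ 0 := by rintro rfl; simp at hτ
  rw [G_eq τ hτ0 _ (by omega)]
  exact ((summable_TT τ hτ K hK).mul_left _).hasSum

theorem tildeG_formula (p q : ℕ) (hp : 1 ≤ p) (hq : 1 ≤ q)
    (hpq : (p, q) ≠ (1, 1)) (τ : ℂ) (hτ : 0 < τ.im) :
    tildeG p q τ =
      G (2 * (p + q)) τ +
      (∑ l ∈ Finset.Ioo 0 (p + q),
        (2 * riemannZeta (2 * (p + q - l)) *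
            (Nat.choose (2 * (p + q - l) - 1) (2 * q - 1) : ℂ) / τ ^ (2 * (p + q - l)) *
            G (2 * l) τ +
         2 * riemannZeta (2 * l) *
            (Nat.choose (2 * l - 1) (2 * p - 1) : ℂ) / τ ^ (2 * l) *
            G (2 * (p + q - l)) τ)) +
      4 / τ ^ (2 * (p + q)) *
        (riemannZeta (2 * p) * riemannZeta (2 * q) - riemannZeta (2 * (p + q)) / 2 -
         ∑ l ∈ Finset.Ioo 0 (p + q),
           riemannZeta (2 * l) * riemannZeta (2 * (p + q - l)) *
             ((Nat.choose (2 * (p + q - l) - 1) (2 * q - 1) : ℂ) +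
              (Nat.choose (2 * l - 1) (2 * p - 1) : ℂ))) := by
  have hτ0 : τ ≠ 0 := by rintro rfl; simp at hτ
  rw [tildeG_eq τ hτ0 p q hp hq]
  refine HasSum.tsum_eq ?_
  have zc : ∀ l ∈ Finset.Ioo 0 (p + q), ZZ (2 * (p + q - l)) = 2 * riemannZeta (2 * (p + q - l)) := by
    intro l hl
    simp only [Finset.mem_Ioo] at hl
    rw [ZZ_even _ (by omega), Nat.cast_sub hl.2.le]
    push_cast
    rfl
  have zl : ∀ l ∈ Finset.Ioo 0 (p + q), ZZ (2 * l) = 2 * riemannZeta (2 * l) := by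
    intro l hl
    simp only [Finset.mem_Ioo] at hl
    rw [ZZ_even _ (by omega)]
  have zN : ZZ (2 * (p + q)) = 2 * riemannZeta (2 * (p + q)) := by
    rw [ZZ_even _ (by omega)]
    push_cast
    rfl
  have zp := ZZ_even p hp
  have zq := ZZ_even q hq
  have tl : ∀ l ∈ Finset.Ioo 0 (p + q), τ ^ (2 * (p + q)) = τ ^ (2 * (p + q - l)) * τ ^ (2 * l) := by
    intro l hl
    simp only [Finset.mem_Ioo] at hl
    rw [← pow_add]
    congr 1
    omega
  have key := ((hasSum_G τ hτ (p + q) (by omega)).add (hasSum_sum (s := Finset.Ioo 0 (p + q))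
    (fun l hl => ((hasSum_G τ hτ l (by simp only [Finset.mem_Ioo] at hl; omega)).mul_left
        (2 * riemannZeta (2 * (p + q - l)) *
            (Nat.choose (2 * (p + q - l) - 1) (2 * q - 1) : ℂ) / τ ^ (2 * (p + q - l)))).add
      ((hasSum_G τ hτ (p + q - l) (by simp only [Finset.mem_Ioo] at hl; omega)).mul_left
        (2 * riemannZeta (2 * l) *
            (Nat.choose (2 * l - 1) (2 * p - 1) : ℂ) / τ ^ (2 * l)))))).add
    (hasSum_ite_eq (0 : ℤ) (4 / τ ^ (2 * (p + q)) *
        (riemannZeta (2 * p) * riemannZeta (2 * q) - riemannZeta (2 * (p + q)) / 2 -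
         ∑ l ∈ Finset.Ioo 0 (p + q),
           riemannZeta (2 * l) * riemannZeta (2 * (p + q - l)) *
             ((Nat.choose (2 * (p + q - l) - 1) (2 * q - 1) : ℂ) +
              (Nat.choose (2 * l - 1) (2 * p - 1) : ℂ)))))
  convert key using 2 with m
  have tN : τ ^ (2 * (p + q)) = τ ^ (2 * p) * τ ^ (2 * q) := by rw [← pow_add]; congr 1; ring
  by_cases hm : m = 0
  · subst hm
    rw [if_pos rfl, Int.cast_zero, zero_div]
    simp only [TT_zero]
    rw [zp, zq, zN, mul_sub, Finset.mul_sum]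
    have : ∑ l ∈ Finset.Ioo 0 (p + q), (2 * riemannZeta (2 * (p + q - l)) *
            (Nat.choose (2 * (p + q - l) - 1) (2 * q - 1) : ℂ) / τ ^ (2 * (p + q - l)) *
            (τ⁻¹ ^ (2 * l) * ZZ (2 * l)) +
         2 * riemannZeta (2 * l) *
            (Nat.choose (2 * l - 1) (2 * p - 1) : ℂ) / τ ^ (2 * l) *
            (τ⁻¹ ^ (2 * (p + q - l)) * ZZ (2 * (p + q - l)))) =
         ∑ l ∈ Finset.Ioo 0 (p + q), 4 / τ ^ (2 * (p + q)) * (riemannZeta (2 * l) * riemannZeta (2 * (p + q - l)) *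
             ((Nat.choose (2 * (p + q - l) - 1) (2 * q - 1) : ℂ) +
              (Nat.choose (2 * l - 1) (2 * p - 1) : ℂ))) := by
      apply Finset.sum_congr rfl
      intro l hl
      rw [zc l hl, zl l hl, tl l hl, inv_pow, inv_pow]
      field_simp
      ring
    rw [this, tN, inv_pow, inv_pow, inv_pow, tN]
    field_simp
    ring
  · rw [if_neg hm, add_zero]
    have hu : ∀ n : ℤ, (m : ℂ) / τ + n ≠ 0 := by
      intro n h
      have h2 : (m : ℂ) + n * τ = 0 := by
        field_simp at h
        linear_combination h
      have h3 := congrArg Complex.im h2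
      simp at h3
      rcases h3 with h3 | h3
      · subst h3
        simp at h2
        exact hm h2
      · exact hτ.ne' h3
    have h := prodT_even _ hu p q hp hq
    rw [mul_mul_mul_comm, h, mul_add, Finset.mul_sum, ← pow_add, ← mul_add]
    congr 1
    apply Finset.sum_congr rfl
    intro l hl
    rw [zc l hl, zl l hl, inv_pow, tl l hl, inv_pow, inv_pow]
    field_simp
end

section
/- For r ≥ 2, positive integers p₁,…,p_r not all 1, and τ in the upper half-plane, G̃*_{2p₁,…,2p_r}(τ) = G̃*_{2p₁,…,2p_{r-2},2(p_{r-1}+p_r)}(τ) + Σ_{l₁+l₂=p_{r-1}+p_r, l₁,l₂≥1} (2ζ(2l₂) binom(2l₂-1, 2p_r-1)/τ^{2l₂}) G̃*_{2p₁,…,2p_{r-2},2l₁}(τ) + Σ_{l₁+l₂=p_{r-1}+p_r, l₁,l₂≥1} (2ζ(2l₁) binom(2l₁-1, 2p_{r-1}-1)/τ^{2l₁}) G̃*_{2p₁,…,2p_{r-2},2l₂}(τ). -/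
/-- `G̃*_{2p₁,…,2p_r}(τ) = Σ_{m≠0} Σ_{n₁,…,n_r ∈ ℤ} Π_j 1/(m+n_jτ)^{2p_j}`. -/
noncomputable def tildeGstar (r : ℕ) (p : Fin r → ℕ) (τ : ℂ) : ℂ :=
  ∑' m : ℤ, if m = 0 then 0
    else ∑' n : Fin r → ℤ, ∏ j, 1 / ((m : ℂ) + n j * τ) ^ (2 * p j)

open Finset in
theorem aux_Q_rec {R : Type*} [CommRing R] (e : R) (D X : R) (a b : ℕ) :
    (∑ t ∈ range (a+1), e^t * ((b+1+t-1).choose t : R) * D^(b+1+t) * X^(a+1-t)) =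
    D * ((∑ t ∈ range (a+1), e^t * ((b+t-1).choose t : R) * D^(b+t) * X^(a+1-t)) +
      e * ∑ t ∈ range a, e^t * ((b+1+t-1).choose t : R) * D^(b+1+t) * X^(a-t)) := by
  rw [sum_range_succ', sum_range_succ' (fun t => e^t * ((b+t-1).choose t : R) * D^(b+t) * X^(a+1-t))]
  rw [show ∀ s₁ s₂ z₁ : R, D * (s₁ + z₁ + e * s₂) = (D * s₁ + D * (e * s₂)) + D * z₁ by intros; ring]
  congr 1
  · simp only [mul_sum, ← sum_add_distrib]
    refine sum_congr rfl fun t _ => ?_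
    rw [show b + 1 + (t+1) - 1 = (b + t) + 1 by omega, show b + (t+1) - 1 = b + t by omega,
      show b + 1 + t - 1 = b + t by omega, Nat.choose_succ_succ, show a + 1 - (t+1) = a - t by omega]
    push_cast
    ring
  · simp
    ring

open Finset in
theorem aux_pf {R : Type*} [CommRing R] (D X Y : R) (h : X * Y = D * (X - Y)) :
    ∀ a b : ℕ, 0 < a + b → X^a * Y^b =
    (∑ t ∈ range a, (-1)^t * ((b+t-1).choose t : R) * D^(b+t) * X^(a-t)) +
    (-1)^a * ∑ t ∈ range b, (1:R)^t * ((a+t-1).choose t : R) * D^(a+t) * Y^(b-t) := by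
  intro a
  induction a with
  | zero =>
    intro b hb
    obtain ⟨b, rfl⟩ : ∃ c, b = c + 1 := ⟨b-1, by omega⟩
    rw [sum_range_succ']
    simp
  | succ a iha =>
    intro b
    induction b with
    | zero =>
      intro _
      rw [sum_range_succ']
      simp
    | succ b ihb =>
      intro _
      have h1 := iha (b+1) (by omega)
      have h2 := ihb (by omega)
      have h3 : X^(a+1) * Y^(b+1) = D * (X^(a+1) * Y^b - X^a * Y^(b+1)) := by
        linear_combination X^a * Y^b * h
      rw [h3, h1, h2, aux_Q_rec, aux_Q_rec 1 D Y b a]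
      ring

theorem aux_telescope_one (g : ℤ → ℂ) (hs : Summable fun n => g (n+1) - g n)
    (h0 : Filter.Tendsto g Filter.cofinite (nhds 0)) :
    HasSum (fun n => g (n+1) - g n) 0 := by
  have h1 : HasSum (fun n : ℕ => g ((n:ℤ)+1) - g n) (0 - g 0) := by
    have hs1 : Summable (fun n : ℕ => g ((n:ℤ)+1) - g n) :=
      hs.comp_injective (i := fun n : ℕ => (n:ℤ)) Nat.cast_injective
    rw [hs1.hasSum_iff_tendsto_nat]
    have : ∀ N : ℕ, ∑ n ∈ Finset.range N, (g ((n:ℤ)+1) - g n) = g N - g 0 := by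
      intro N
      simpa using Finset.sum_range_sub (fun n : ℕ => g n) N
    simp only [this]
    refine Filter.Tendsto.sub_const ?_ _
    have := h0.comp (Nat.cast_injective (R := ℤ)).tendsto_cofinite
    rwa [Nat.cofinite_eq_atTop] at this
  have hi : Function.Injective (fun n : ℕ => -((n:ℤ))) := fun a b h => by simpa using h
  have hi' : Function.Injective (fun n : ℕ => -((n:ℤ)+1)) := fun a b h => by simpa using h
  have h2 : HasSum (fun n : ℕ => g (-((n:ℤ)+1)+1) - g (-((n:ℤ)+1))) (g 0 - 0) := by
    have hs1 : Summable (fun n : ℕ => g (-((n:ℤ)+1)+1) - g (-((n:ℤ)+1))) :=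
      hs.comp_injective (i := fun n : ℕ => -((n:ℤ)+1)) hi'
    rw [hs1.hasSum_iff_tendsto_nat]
    have : ∀ N : ℕ, ∑ n ∈ Finset.range N, (g (-((n:ℤ)+1)+1) - g (-((n:ℤ)+1))) = g 0 - g (-N) := by
      intro N
      have := Finset.sum_range_sub' (fun n : ℕ => g (-n)) N
      simpa using this
    simp only [this]
    refine Filter.Tendsto.const_sub _ ?_
    have := h0.comp hi.tendsto_cofinite
    rwa [Nat.cofinite_eq_atTop] at this
  simpa using HasSum.of_nat_of_neg_add_one (f := fun n => g (n+1) - g n) h1 h2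

theorem aux_telescope (g : ℤ → ℂ) (hs : Summable fun n => g (n+1) - g n)
    (h0 : Filter.Tendsto g Filter.cofinite (nhds 0)) (k : ℤ) :
    HasSum (fun n => g (n+k) - g n) 0 := by
  have h1 := aux_telescope_one g hs h0
  have sh : ∀ j : ℤ, HasSum (fun n => g (n+j+1) - g (n+j)) 0 := fun j =>
    (Equiv.addRight j).hasSum_iff.mpr h1
  induction k using Int.induction_on with
  | zero => simp
  | succ i ih =>
    convert ih.add (sh i) using 1
    · ext n; rw [add_assoc]; ring
    · simp
  | pred i ih =>
    have h := ih.sub (sh (-(i:ℤ)-1))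
    rw [sub_zero] at h
    suffices e : (fun n => g (n + (-(i:ℤ)-1)) - g n) = fun n =>
        (g (n + -(i:ℤ)) - g n) - (g (n + (-(i:ℤ)-1) + 1) - g (n + (-(i:ℤ)-1))) by
      rw [e]; exact h
    funext n
    rw [show n + (-(i:ℤ)-1) + 1 = n + -(i:ℤ) by ring]
    ring

open Finset in
/-- per-shift sum -/
theorem aux_Sk (X : ℤ → ℂ) (D : ℂ) (k : ℤ) (hX : ∀ n, X n * X (n+k) = D * (X n - X (n+k)))
    (τ : ℂ) (h1 : ∀ n, X (n+1) - X n = - τ * (X n * X (n+1)))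
    (hs : ∀ i, 2 ≤ i → Summable fun n => X n ^ i) (a b : ℕ) :
    HasSum (fun n => X n ^ (a+1) * X (n+k)^(b+1))
      ((∑ t ∈ range a, (-1)^t * ((b+1+t-1).choose t : ℂ) * D^(b+1+t) * ∑' n, X n^(a+1-t)) +
    (-1)^(a+1) * ∑ t ∈ range b, ((a+1+t-1).choose t : ℂ) * D^(a+1+t) * ∑' n, X n^(b+1-t)) := by
  have h0 : Filter.Tendsto X Filter.cofinite (nhds 0) := by
    have := (hs 2 le_rfl).tendsto_cofinite_zero
    rw [tendsto_zero_iff_norm_tendsto_zero] at this ⊢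
    have := this.sqrt
    simpa [norm_pow] using this
  have hsum : Summable fun n => X (n+1) - X n := by
    simp only [h1]
    refine Summable.mul_left _ ?_
    have e1 := (hs 2 le_rfl).norm
    have e2 : Summable fun n : ℤ => ‖X (n+1)^2‖ :=
      e1.comp_injective (i := fun n : ℤ => n + 1) (add_left_injective 1)
    refine Summable.of_norm_bounded (e1.add e2) fun n => ?_
    simp only [norm_mul, norm_pow]
    nlinarith [sq_nonneg (‖X n‖ - ‖X (n+1)‖), sq_nonneg (‖X n‖), sq_nonneg (‖X (n+1)‖)]
  have tel := aux_telescope X hsum h0 k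
  have hsh : ∀ i, 2 ≤ i → HasSum (fun n => X (n+k) ^ i) (∑' n, X n ^ i) := fun i hi =>
    (Equiv.addRight k).hasSum_iff.mpr (hs i hi).hasSum
  have A : HasSum (fun n => ∑ t ∈ range a, (-1)^t * ((b+1+t-1).choose t : ℂ) * D^(b+1+t) * X n^(a+1-t))
     (∑ t ∈ range a, (-1)^t * ((b+1+t-1).choose t : ℂ) * D^(b+1+t) * ∑' n, X n^(a+1-t)) :=
    hasSum_sum fun t ht => ((hs _ (by have := mem_range.mp ht; omega)).hasSum.mul_left _)
  have B : HasSum (fun n => ∑ t ∈ range b, ((a+1+t-1).choose t : ℂ) * D^(a+1+t) * X (n+k)^(b+1-t))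
     (∑ t ∈ range b, ((a+1+t-1).choose t : ℂ) * D^(a+1+t) * ∑' n, X n^(b+1-t)) :=
    hasSum_sum fun t ht => ((hsh _ (by have := mem_range.mp ht; omega)).mul_left _)
  convert (A.add (B.mul_left ((-1)^(a+1)))).add
    (tel.mul_left ((-1)^(a+1) * ((a+b).choose a : ℂ) * D^(a+b+1))) using 1
  · ext n
    rw [aux_pf D _ _ (hX n) (a+1) (b+1) (by omega), sum_range_succ, sum_range_succ _ b]
    simp only [one_pow, one_mul]
    rw [show b + 1 + a - 1 = a + b by omega, show a + 1 + b - 1 = a + b by omega,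
      show (a+b).choose b = (a+b).choose a from by rw [Nat.choose_symm_add]]
    rw [show a + 1 - a = 1 by omega, show b + 1 - b = 1 by omega]
    ring
  · ring

open Finset in
theorem aux_FF (X : ℤ → ℂ) (τ : ℂ) (hτ : τ ≠ 0)
    (hX : ∀ n k : ℤ, X n * X (n+k) * (k * τ) = (X n - X (n+k)))
    (hs : ∀ i, 2 ≤ i → Summable fun n => X n ^ i) (a b : ℕ) (ha : 1 ≤ a) (hb : 1 ≤ b) :
    (∑' n, X n^(a+1)) * (∑' n, X n^(b+1)) = ∑' n, X n^(a+b+2) +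
    ((∑ t ∈ range a, (-1)^t * ((b+1+t-1).choose t : ℂ) * (∑' k : ℤ, ((k * τ : ℂ)⁻¹)^(b+1+t)) * ∑' n, X n^(a+1-t)) +
    (-1)^(a+1) * ∑ t ∈ range b, ((a+1+t-1).choose t : ℂ) * (∑' k : ℤ, ((k * τ : ℂ)⁻¹)^(a+1+t)) * ∑' n, X n^(b+1-t)) := by
  have hA := (hs (a+1) (by omega)).norm
  have hB := (hs (b+1) (by omega)).norm
  have hprod : Summable fun z : ℤ × ℤ => X z.1^(a+1) * X z.2^(b+1) :=
    summable_mul_of_summable_norm (f := fun n => X n^(a+1)) (g := fun n => X n^(b+1)) hA hB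
  rw [tsum_mul_tsum_of_summable_norm hA hB]
  let e : ℤ × ℤ ≃ ℤ × ℤ :=
    { toFun := fun z => (z.2, z.2 + z.1)
      invFun := fun z => (z.2 - z.1, z.1)
      left_inv := fun z => by simp
      right_inv := fun z => by simp }
  have hprod' : Summable fun z : ℤ × ℤ => X z.2^(a+1) * X (z.2+z.1)^(b+1) := e.summable_iff.mpr hprod
  rw [← e.tsum_eq (fun z : ℤ × ℤ => X z.1^(a+1) * X z.2^(b+1))]
  show ∑' z : ℤ × ℤ, X z.2^(a+1) * X (z.2+z.1)^(b+1) = _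
  rw [hprod'.tsum_prod]
  have hk : ∀ k : ℤ, ∑' n, X n^(a+1) * X (n+k)^(b+1) = (if k = 0 then ∑' n, X n^(a+b+2) else 0) +
    ((∑ t ∈ range a, (-1)^t * ((b+1+t-1).choose t : ℂ) * ((k * τ : ℂ)⁻¹)^(b+1+t) * ∑' n, X n^(a+1-t)) +
    (-1)^(a+1) * ∑ t ∈ range b, ((a+1+t-1).choose t : ℂ) * ((k * τ : ℂ)⁻¹)^(a+1+t) * ∑' n, X n^(b+1-t)) := by
    intro k
    split_ifs with h
    · subst h
      have z1 : ∀ j t : ℕ, (((0:ℤ) * τ : ℂ)⁻¹)^(j+1+t) = 0 := by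
        intro j t; simp
      simp only [z1]
      simp only [add_zero, mul_zero, zero_mul, sum_const_zero]
      refine tsum_congr fun n => ?_
      ring
    · rw [zero_add]
      have hkτ : (k * τ : ℂ) ≠ 0 := mul_ne_zero (by exact_mod_cast h) hτ
      refine (aux_Sk X _ k (fun n => ?_) τ (fun n => ?_) hs a b).tsum_eq
      · rw [← hX n k]; field_simp
      · have := hX n 1
        push_cast at this
        linear_combination this
  rw [tsum_congr hk]
  have hZ : ∀ j t : ℕ, 1 ≤ j → Summable fun k : ℤ => ((k * τ : ℂ)⁻¹)^(j+1+t) := by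
    intro j t hj
    have := EisensteinSeries.linear_left_summable hτ 0 (k := (j+1+t : ℕ)) (by omega)
    simpa only [zpow_natCast, Int.cast_zero, add_zero, inv_pow] using this
  refine HasSum.tsum_eq ?_
  refine HasSum.add (hasSum_ite_eq _ _) (HasSum.add ?_ (HasSum.mul_left _ ?_))
  · exact hasSum_sum fun t ht => ((hZ b t hb).hasSum.mul_left _).mul_right _
  · exact hasSum_sum fun t ht => ((hZ a t ha).hasSum.mul_left _).mul_right _

theorem aux_summ_pnat (τ : ℂ) (hτ : 0 < τ.im) (p : ℕ) (hp : 1 ≤ p) :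
    Summable fun m : ℕ+ => ∑' n : ℤ, (((m:ℂ) + n * τ)⁻¹)^(2*p) := by
  have hτ0 : τ ≠ 0 := by rintro rfl; simp at hτ
  have him : 0 < (-τ⁻¹).im := by
    simp only [Complex.neg_im, Complex.inv_im, neg_div, neg_neg]
    exact div_pos hτ (Complex.normSq_pos.mpr hτ0)
  let w : UpperHalfPlane := ⟨-τ⁻¹, him⟩
  have hr : ‖Complex.exp (2 * Real.pi * Complex.I * w)‖ < 1 := UpperHalfPlane.norm_exp_two_pi_I_lt_one w
  have hS := (summable_prod_mul_pow (2*p-1) hr).prod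
  have key : ∀ m : ℕ+, ∑' n : ℤ, (((m:ℂ) + n * τ)⁻¹)^(2*p) =
      (τ⁻¹)^(2*p) * ((-2 * Real.pi * Complex.I) ^ (2*p-1 + 1) / (2*p-1).factorial) *
       ∑' n : ℕ+, (n:ℂ) ^ (2*p-1) * Complex.exp (2 * Real.pi * Complex.I * w) ^ ((m:ℕ) * n : ℕ) := by
    intro m
    have hm : 0 < ((m:ℂ) * (w:ℂ)).im := by
      have : (0:ℝ) < (m:ℕ) := by exact_mod_cast m.pos
      simpa using mul_pos this w.2
    have H := EisensteinSeries.qExpansion_identity_pnat (k := 2*p-1) (by omega) ⟨(m:ℂ) * w, hm⟩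
    rw [mul_assoc]
    have e : ∀ n : ℕ+, (n:ℂ) ^ (2*p-1) * Complex.exp (2 * Real.pi * Complex.I * w) ^ ((m:ℕ) * n : ℕ)
      = (n:ℂ) ^ (2*p-1) * Complex.exp (2 * Real.pi * Complex.I * ((m:ℂ) * w)) ^ (n : ℕ) := by
      intro n
      rw [pow_mul, ← Complex.exp_nat_mul]
      congr 3
      ring
    rw [tsum_congr e]
    erw [← H]
    rw [← tsum_mul_left, ← (Equiv.neg ℤ).tsum_eq]
    refine tsum_congr fun n => ?_
    have hw : (w:ℂ) = -τ⁻¹ := rfl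
    show (((m:ℂ) + ((-n : ℤ):ℂ) * τ)⁻¹)^(2*p) = τ⁻¹^(2*p) * (1 / ((m:ℂ) * (w:ℂ) + n)^(2*p-1+1))
    rw [hw, show 2*p-1+1 = 2*p by omega, one_div, ← inv_pow, ← mul_pow, ← mul_inv]
    rw [pow_mul, pow_mul, inv_pow, inv_pow]
    push_cast
    field_simp
    ring
  simp only [key]
  exact hS.mul_left _

theorem aux_summ_int (τ : ℂ) (hτ : 0 < τ.im) (p : ℕ) (hp : 1 ≤ p) :
    Summable fun m : ℤ => if m = 0 then 0 else ∑' n : ℤ, (((m:ℂ) + n * τ)⁻¹)^(2*p) := by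
  have h := aux_summ_pnat τ hτ p hp
  have h1 : Summable fun m : ℕ => ∑' n : ℤ, ((((m+1 : ℕ):ℂ) + n * τ)⁻¹)^(2*p) :=
    (summable_pnat_iff_summable_succ (f := fun m : ℕ => ∑' n : ℤ, (((m:ℂ) + n * τ)⁻¹)^(2*p))).mp h
  refine Summable.of_add_one_of_neg_add_one (h1.congr fun m => ?_) (h1.congr fun m => ?_)
  · rw [if_neg (by omega)]; push_cast; rfl
  · rw [if_neg (by omega), ← (Equiv.neg ℤ).tsum_eq]
    refine tsum_congr fun n => ?_
    rw [Equiv.neg_apply]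
    have e : (((-((m:ℤ)+1) : ℤ) : ℂ) + ((n:ℤ):ℂ) * τ) = -(((m+1 : ℕ) : ℂ) + ((-n : ℤ):ℂ) * τ) := by
      push_cast; ring
    rw [e, inv_neg, Even.neg_pow (even_two_mul p)]

theorem aux_ne (τ : ℂ) (hτ : 0 < τ.im) (m : ℤ) (hm : m ≠ 0) (n : ℤ) : (m:ℂ) + n * τ ≠ 0 := by
  intro h
  have h1 := congrArg Complex.im h
  simp at h1
  rcases h1 with h1 | h1
  · subst h1
    simp at h
    exact hm h
  · exact hτ.ne' h1

theorem aux_summ_n (τ : ℂ) (hτ : 0 < τ.im) (m : ℤ) (i : ℕ) (hi : 2 ≤ i) :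
    Summable fun n : ℤ => (((m:ℂ) + n * τ)⁻¹)^i := by
  have hτ0 : τ ≠ 0 := by rintro rfl; simp at hτ
  have := EisensteinSeries.linear_left_summable hτ0 m (k := (i:ℕ)) (by omega)
  simpa only [zpow_natCast, inv_pow, add_comm] using this

theorem aux_pi (r : ℕ) (f : Fin r → ℤ → ℂ) (hf : ∀ j, Summable fun n => ‖f j n‖) :
    (Summable fun n : Fin r → ℤ => ‖∏ j, f j (n j)‖) ∧
    ∑' n : Fin r → ℤ, ∏ j, f j (n j) = ∏ j, ∑' n, f j n := by
  induction r with
  | zero => exact ⟨(hasSum_fintype _).summable, by simp [tsum_fintype]⟩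
  | succ r ih =>
    obtain ⟨i1, i2⟩ := ih (fun j => f j.castSucc) (fun j => hf _)
    have e : ∀ z : ℤ × (Fin r → ℤ), ∏ j, f j ((Fin.snocEquiv (fun _ => ℤ)) z j) =
        f (Fin.last r) z.1 * ∏ j : Fin r, f j.castSucc (z.2 j) := by
      intro z
      rw [Fin.prod_univ_castSucc, mul_comm]
      simp
    constructor
    · rw [← (Fin.snocEquiv (fun _ => ℤ)).summable_iff]
      have := Summable.mul_norm (hf (Fin.last r)) i1
      refine this.congr fun z => ?_
      show _ = ‖∏ j, f j ((Fin.snocEquiv (fun _ => ℤ)) z j)‖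
      rw [e]
    · rw [← (Fin.snocEquiv (fun _ => ℤ)).tsum_eq, tsum_congr e,
        ← tsum_mul_tsum_of_summable_norm (hf (Fin.last r)) i1, i2, Fin.prod_univ_castSucc, mul_comm]

noncomputable def auxF (τ : ℂ) (i : ℕ) (m : ℤ) : ℂ :=
  if m = 0 then 0 else ∑' n : ℤ, (((m:ℂ) + n * τ)⁻¹)^i

theorem aux_prod_bdd (r : ℕ) (p : Fin r → ℕ) (hp : ∀ j, 1 ≤ p j) (τ : ℂ) (hτ : 0 < τ.im) :
    ∃ C, ∀ m, ‖∏ j, auxF τ (2 * p j) m‖ ≤ C := by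
  have : ∀ j, ∃ C, ∀ m, ‖auxF τ (2 * p j) m‖ ≤ C := by
    intro j
    have hs : Summable fun m => ‖auxF τ (2 * p j) m‖ := (aux_summ_int τ hτ (p j) (hp j)).norm
    exact ⟨_, fun m => hs.le_tsum m (fun _ _ => norm_nonneg _)⟩
  choose C hC using this
  refine ⟨∏ j, C j, fun m => ?_⟩
  rw [norm_prod]
  exact Finset.prod_le_prod (fun _ _ => norm_nonneg _) fun j _ => hC j m

theorem aux_prod_summ (r : ℕ) (p : Fin r → ℕ) (hp : ∀ j, 1 ≤ p j) (τ : ℂ) (hτ : 0 < τ.im)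
    (l : ℕ) (hl : 1 ≤ l) : Summable fun m => (∏ j, auxF τ (2 * p j) m) * auxF τ (2 * l) m := by
  obtain ⟨C, hC⟩ := aux_prod_bdd r p hp τ hτ
  have hs : Summable fun m => ‖auxF τ (2 * l) m‖ := (aux_summ_int τ hτ l hl).norm
  refine Summable.of_norm_bounded (hs.mul_left C) fun m => ?_
  rw [norm_mul]
  exact mul_le_mul_of_nonneg_right (hC m) (norm_nonneg _)

theorem aux_tilde (r : ℕ) (p : Fin (r+1) → ℕ) (hp : ∀ j, 1 ≤ p j) (τ : ℂ) (hτ : 0 < τ.im) :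
    tildeGstar (r+1) p τ = ∑' m, ∏ j, auxF τ (2 * p j) m := by
  unfold tildeGstar
  refine tsum_congr fun m => ?_
  by_cases h : m = 0
  · rw [if_pos h, Fin.prod_univ_succ]
    simp [auxF, h]
  · rw [if_neg h]
    have := (aux_pi (r+1) (fun j n => (((m:ℂ) + n * τ)⁻¹)^(2 * p j))
      (fun j => (aux_summ_n τ hτ m _ (by have := hp j; omega)).norm)).2
    simp only [auxF, if_neg h, one_div, ← inv_pow]
    exact this

theorem aux_Z_odd (τ : ℂ) (j : ℕ) (hj : Odd j) : ∑' k : ℤ, ((k * τ : ℂ)⁻¹)^j = 0 := by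
  have h : ∑' k : ℤ, ((k * τ : ℂ)⁻¹)^j = -∑' k : ℤ, ((k * τ : ℂ)⁻¹)^j := by
    conv_lhs => rw [← (Equiv.neg ℤ).tsum_eq]
    rw [← tsum_neg]
    refine tsum_congr fun n => ?_
    rw [Equiv.neg_apply]
    push_cast
    rw [neg_mul, inv_neg, hj.neg_pow]
  exact self_eq_neg.mp h

theorem aux_Z_even (τ : ℂ) (j : ℕ) (hj : 1 ≤ j) :
    ∑' k : ℤ, ((k * τ : ℂ)⁻¹)^(2*j) = 2 * riemannZeta (2 * j) / τ^(2*j) := by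
  have h := two_mul_riemannZeta_eq_tsum_int_inv_pow_of_even (k := 2*j) (by omega) (even_two_mul j)
  push_cast at h
  rw [h, ← tsum_div_const]
  refine tsum_congr fun n => ?_
  rw [inv_pow, mul_pow, mul_inv, div_eq_mul_inv]

theorem aux_reindex (f g : ℕ → ℂ) (p N : ℕ) (hp : 1 ≤ p) (hN : p < N)
    (hodd : ∀ t, Odd t → f t = 0) (hg : ∀ l, 1 ≤ l → l ≤ p → g l = f (2 * (p - l)))
    (hg0 : ∀ l, p < l → l < N → g l = 0) :
    ∑ t ∈ Finset.range (2*p-1), f t = ∑ l ∈ Finset.Ioo 0 N, g l := by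
  symm
  refine Finset.sum_bij_ne_zero (fun l _ _ => 2 * (p - l)) ?_ ?_ ?_ ?_
  · intro l hl h0
    have := Finset.mem_Ioo.mp hl
    rw [Finset.mem_range]; omega
  · intro l hl h0 l' hl' h0' h
    have h1 := Finset.mem_Ioo.mp hl
    have h2 := Finset.mem_Ioo.mp hl'
    have h3 : l ≤ p := by by_contra hc; exact h0 (hg0 l (by omega) h1.2)
    have h4 : l' ≤ p := by by_contra hc; exact h0' (hg0 l' (by omega) h2.2)
    omega
  · intro t ht h0
    have h1 := Finset.mem_range.mp ht
    obtain ⟨u, hu⟩ : Even t := by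
      rw [← Nat.not_odd_iff_even]; exact fun hc => h0 (hodd t hc)
    refine ⟨p - u, Finset.mem_Ioo.mpr (by omega), ?_, by omega⟩
    rw [hg _ (by omega) (by omega), show 2 * (p - (p-u)) = t by omega]
    exact h0
  · intro l hl h0
    have h1 := Finset.mem_Ioo.mp hl
    have h3 : l ≤ p := by by_contra hc; exact h0 (hg0 l (by omega) h1.2)
    exact hg l h1.1 h3

theorem aux_half (F : ℕ → ℂ) (τ : ℂ) (p q : ℕ) (hp : 1 ≤ p) (hq : 1 ≤ q) (e : ℂ)
    (he : e = 1 ∨ e = -1) :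
    ∑ t ∈ Finset.range (2*p-1), e^t * ((2*q-1+1+t-1).choose t : ℂ) *
      (∑' k : ℤ, ((k * τ : ℂ)⁻¹)^(2*q-1+1+t)) * F (2*p-1+1-t) =
    ∑ l ∈ Finset.Ioo 0 (p+q), 2 * riemannZeta (2 * ((p:ℂ) + q - l)) *
          (Nat.choose (2 * (p + q - l) - 1) (2 * q - 1) : ℂ) / τ ^ (2 * (p + q - l)) * F (2*l) := by
  refine aux_reindex _ _ p (p+q) hp (by omega) ?_ ?_ ?_
  · intro t ht
    rw [aux_Z_odd τ _ (by
      rw [show 2*q-1+1+t = 2*q + t by omega]; exact Even.add_odd (even_two_mul q) ht)]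
    simp
  · intro l h1 h2
    rw [show 2*q-1+1+2*(p-l) = 2*(p+q-l) by omega, aux_Z_even τ _ (by omega),
      show 2*p-1+1-2*(p-l) = 2*l by omega, pow_mul e]
    have e2 : e^2 = 1 := by rcases he with rfl | rfl <;> norm_num
    have hc : (2*(p+q-l)-1).choose (2*(p-l)) = (2*(p+q-l)-1).choose (2*q-1) :=
      Nat.choose_symm_of_eq_add (by omega)
    rw [e2, one_pow, hc, Nat.cast_sub (by omega)]
    push_cast
    ring
  · intro l h1 h2
    rw [Nat.choose_eq_zero_of_lt (by omega)]
    simp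

theorem aux_point (τ : ℂ) (hτ : 0 < τ.im) (p q : ℕ) (hp : 1 ≤ p) (hq : 1 ≤ q) (m : ℤ) :
    auxF τ (2*p) m * auxF τ (2*q) m = auxF τ (2*(p+q)) m +
    (∑ l ∈ Finset.Ioo 0 (p+q), 2 * riemannZeta (2 * ((p:ℂ) + q - l)) *
          (Nat.choose (2 * (p + q - l) - 1) (2 * q - 1) : ℂ) / τ ^ (2 * (p + q - l)) * auxF τ (2*l) m) +
    (∑ l ∈ Finset.Ioo 0 (p+q), 2 * riemannZeta (2 * (l:ℂ)) *
          (Nat.choose (2 * l - 1) (2 * p - 1) : ℂ) / τ ^ (2 * l) * auxF τ (2*(p+q-l)) m) := by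
  by_cases hm : m = 0
  · simp [auxF, hm]
  have hτ0 : τ ≠ 0 := by rintro rfl; simp at hτ
  have hF : ∀ i, auxF τ i m = ∑' n : ℤ, (((m:ℂ) + n * τ)⁻¹)^i := fun i => by
    simp [auxF, hm]
  have key := aux_FF (fun n : ℤ => ((m:ℂ) + n * τ)⁻¹) τ hτ0 (fun n k => by
      have h1 := aux_ne τ hτ m hm n
      have h2 := aux_ne τ hτ m hm (n+k)
      rw [inv_sub_inv h1 h2, ← mul_inv, inv_mul_eq_div]
      push_cast
      ring) (fun i hi => aux_summ_n τ hτ m i hi) (2*p-1) (2*q-1) (by omega) (by omega)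
  simp only [← hF] at key
  have r1 := aux_half (fun i => auxF τ i m) τ p q hp hq (-1) (Or.inr rfl)
  have r2 := aux_half (fun i => auxF τ i m) τ q p hq hp 1 (Or.inl rfl)
  simp only [one_pow, one_mul] at r2
  rw [r1, r2, Even.neg_one_pow (by rw [show 2*p-1+1 = 2*p by omega]; exact even_two_mul p), one_mul,
    show 2*p-1+1 = 2*p by omega, show 2*q-1+1 = 2*q by omega,
    show 2*p-1+(2*q-1)+2 = 2*(p+q) by omega, ← add_assoc] at key
  rw [key]
  congr 1
  refine Finset.sum_nbij' (fun l => p + q - l) (fun l => p + q - l) ?_ ?_ ?_ ?_ ?_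
  · intro l hl; simp only [Finset.mem_Ioo] at *; omega
  · intro l hl; simp only [Finset.mem_Ioo] at *; omega
  · intro l hl; simp only [Finset.mem_Ioo] at *; omega
  · intro l hl; simp only [Finset.mem_Ioo] at *; omega
  · intro l hl
    simp only [Finset.mem_Ioo] at hl
    rw [Nat.cast_sub (by omega), show p + q - (p + q - l) = l by omega, show q + p - l = p + q - l by omega]
    push_cast
    rw [add_comm (q:ℂ) p]

theorem tildeGstar_recursion (s : ℕ) (p : Fin (s + 2) → ℕ)
    (hp : ∀ j, 1 ≤ p j) (hp1 : p ≠ fun _ => 1) (τ : ℂ) (hτ : 0 < τ.im) :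
    tildeGstar (s + 2) p τ =
      tildeGstar (s + 1)
        (Fin.snoc (fun j => p (Fin.castAdd 2 j))
          (p (Fin.castSucc (Fin.last s)) + p (Fin.last (s + 1)))) τ +
      (∑ l ∈ Finset.Ioo 0 (p (Fin.castSucc (Fin.last s)) + p (Fin.last (s + 1))),
        2 * riemannZeta (2 * (p (Fin.castSucc (Fin.last s)) + p (Fin.last (s + 1)) - l)) *
          (Nat.choose (2 * (p (Fin.castSucc (Fin.last s)) + p (Fin.last (s + 1)) - l) - 1)
            (2 * p (Fin.last (s + 1)) - 1) : ℂ) /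
          τ ^ (2 * (p (Fin.castSucc (Fin.last s)) + p (Fin.last (s + 1)) - l)) *
          tildeGstar (s + 1) (Fin.snoc (fun j => p (Fin.castAdd 2 j)) l) τ) +
      (∑ l ∈ Finset.Ioo 0 (p (Fin.castSucc (Fin.last s)) + p (Fin.last (s + 1))),
        2 * riemannZeta (2 * l) *
          (Nat.choose (2 * l - 1) (2 * p (Fin.castSucc (Fin.last s)) - 1) : ℂ) /
          τ ^ (2 * l) *
          tildeGstar (s + 1)
            (Fin.snoc (fun j => p (Fin.castAdd 2 j))
              (p (Fin.castSucc (Fin.last s)) + p (Fin.last (s + 1)) - l)) τ) := by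
  have hq : ∀ j : Fin s, 1 ≤ p (Fin.castAdd 2 j) := fun j => hp _
  have hsn : ∀ l, 1 ≤ l → tildeGstar (s + 1) (Fin.snoc (fun j => p (Fin.castAdd 2 j)) l) τ =
      ∑' m, (∏ j : Fin s, auxF τ (2 * p (Fin.castAdd 2 j)) m) * auxF τ (2 * l) m := by
    intro l hl
    rw [aux_tilde s _ (fun j => by
      refine Fin.lastCases ?_ (fun i => ?_) j
      · simpa using hl
      · simpa using hq i) τ hτ]
    refine tsum_congr fun m => ?_
    rw [Fin.prod_univ_castSucc]
    simp
  have hss : ∀ l, 1 ≤ l → HasSum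
      (fun m => (∏ j : Fin s, auxF τ (2 * p (Fin.castAdd 2 j)) m) * auxF τ (2 * l) m)
      (tildeGstar (s + 1) (Fin.snoc (fun j => p (Fin.castAdd 2 j)) l) τ) := by
    intro l hl
    rw [hsn l hl]
    exact (aux_prod_summ s _ hq τ hτ l hl).hasSum
  rw [aux_tilde (s+1) p hp τ hτ]
  have hP := hp (Fin.castSucc (Fin.last s))
  have hQ := hp (Fin.last (s+1))
  have hmain : ∀ m, ∏ j, auxF τ (2 * p j) m =
      (∏ j : Fin s, auxF τ (2 * p (Fin.castAdd 2 j)) m) *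
       (auxF τ (2 * p (Fin.castSucc (Fin.last s))) m * auxF τ (2 * p (Fin.last (s+1))) m) := by
    intro m
    rw [Fin.prod_univ_castSucc, Fin.prod_univ_castSucc, mul_assoc]
    rfl
  generalize p (Fin.castSucc (Fin.last s)) = P at *
  generalize p (Fin.last (s+1)) = Q at *
  refine HasSum.tsum_eq ?_
  have hfin := ((hss (P+Q) (by omega)).add (hasSum_sum (s := Finset.Ioo 0 (P+Q)) fun l hl =>
    (hss l (by have := Finset.mem_Ioo.mp hl; omega)).mul_left
      (2 * riemannZeta (2 * ((P:ℂ) + Q - l)) *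
          (Nat.choose (2 * (P + Q - l) - 1) (2 * Q - 1) : ℂ) / τ ^ (2 * (P + Q - l))))).add
    (hasSum_sum (s := Finset.Ioo 0 (P+Q)) fun l hl =>
    (hss (P+Q-l) (by have := Finset.mem_Ioo.mp hl; omega)).mul_left
      (2 * riemannZeta (2 * (l:ℂ)) *
          (Nat.choose (2 * l - 1) (2 * P - 1) : ℂ) / τ ^ (2 * l)))
  have e : (fun m => ∏ j, auxF τ (2 * p j) m) = _ := funext fun m => (hmain m).trans (by
    rw [aux_point τ hτ P Q hP hQ m, mul_add, mul_add, Finset.mul_sum, Finset.mul_sum])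
  rw [e]
  convert hfin using 1
  funext m
  congr 1
  · congr 1
    exact Finset.sum_congr rfl fun l _ => by ring
  · exact Finset.sum_congr rfl fun l _ => by ring
end

section
/- For every τ in the upper half-plane, the triple series G̃_{2,2,2}(τ) (taken in the iterated order of summation) satisfies G̃_{2,2,2}(τ) = G₆(τ) + (π²/τ²) G₄(τ) + (8π⁴/(15τ⁴)) G₂(τ) − 52π⁶/(315τ⁶). -/
open Real

/-- The triple Eisenstein-type series `G̃_{2p₁,2p₂,2p₃}(τ)` (iterated order). -/
noncomputable def tildeG3 (p₁ p₂ p₃ : ℕ) (τ : ℂ) : ℂ :=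
  ∑' m : ℤ, ∑' n₁ : ℤ, ∑' n₂ : ℤ, ∑' n₃ : ℤ,
    if (m = 0 ∧ n₁ = 0) ∨ (m = 0 ∧ n₂ = 0) ∨ (m = 0 ∧ n₃ = 0) then 0
    else 1 / (((m : ℂ) + n₁ * τ) ^ (2 * p₁) * ((m : ℂ) + n₂ * τ) ^ (2 * p₂) *
              ((m : ℂ) + n₃ * τ) ^ (2 * p₃))

/-- Row sum of the Eisenstein series. -/
noncomputable def rowS (k : ℕ) (τ : ℂ) (m : ℤ) : ℂ := ∑' n : ℤ, 1 / ((m : ℂ) + n * τ) ^ k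

lemma G_eq_rowS (k : ℕ) (hk : k ≠ 0) (τ : ℂ) : G k τ = ∑' m : ℤ, rowS k τ m := by
  unfold G rowS
  refine tsum_congr fun m => tsum_congr fun n => ?_
  split_ifs with h
  · simp [h.1, h.2, hk]
  · rfl

lemma tildeG3_eq_rowS (τ : ℂ) : tildeG3 1 1 1 τ = ∑' m : ℤ, rowS 2 τ m ^ 3 := by
  unfold tildeG3
  refine tsum_congr fun m => ?_
  have h : ∀ n₁ n₂ n₃ : ℤ,
      (if (m = 0 ∧ n₁ = 0) ∨ (m = 0 ∧ n₂ = 0) ∨ (m = 0 ∧ n₃ = 0) then (0 : ℂ)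
    else 1 / (((m : ℂ) + n₁ * τ) ^ (2 * 1) * ((m : ℂ) + n₂ * τ) ^ (2 * 1) *
              ((m : ℂ) + n₃ * τ) ^ (2 * 1))) =
      1 / ((m : ℂ) + n₁ * τ) ^ 2 * (1 / ((m : ℂ) + n₂ * τ) ^ 2 * (1 / ((m : ℂ) + n₃ * τ) ^ 2)) := by
    intro n₁ n₂ n₃
    split_ifs with h
    · rcases h with h | h | h <;> simp [h.1, h.2]
    · simp only [mul_one, one_div, mul_inv, mul_assoc]
  simp_rw [h, tsum_mul_left, tsum_mul_right]
  unfold rowS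
  ring

lemma rowS_neg (k : ℕ) (hk : Even k) (τ : ℂ) (m : ℤ) : rowS k τ (-m) = rowS k τ m := by
  unfold rowS
  rw [← (Equiv.neg ℤ).tsum_eq]
  refine tsum_congr fun n => ?_
  rw [← hk.neg_pow]
  simp only [Equiv.neg_apply]
  push_cast
  ring_nf

lemma choose_cast (n k : ℕ) : ((n + (k + 1)).choose (k + 1) : ℂ) =
    (n + k + 1) * ((n + k).choose k : ℂ) / (k + 1) := by
  have h := Nat.add_one_mul_choose_eq (n + k) k
  have h' := congrArg (Nat.cast (R := ℂ)) h
  push_cast at h'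
  have hk : (k : ℂ) + 1 ≠ 0 := by exact_mod_cast Nat.succ_ne_zero k
  rw [eq_div_iff hk, ← add_assoc, ← h']

lemma tsum_pows (q : ℂ) (hq : ‖q‖ < 1) :
    ∑' n : ℕ, (n : ℂ) ^ 1 * q ^ n = q / (1 - q) ^ 2 ∧
    ∑' n : ℕ, (n : ℂ) ^ 3 * q ^ n = q * (1 + 4 * q + q ^ 2) / (1 - q) ^ 4 ∧
    ∑' n : ℕ, (n : ℂ) ^ 5 * q ^ n =
      q * (1 + 26 * q + 66 * q ^ 2 + 26 * q ^ 3 + q ^ 4) / (1 - q) ^ 6 := by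
  have h1 : 1 - q ≠ 0 := by
    intro h
    rw [← sub_eq_zero.mp h] at hq
    simp at hq
  have H := fun k => hasSum_choose_mul_geometric_of_norm_lt_one (𝕜 := ℂ) k hq
  have H0 := H 0
  have H1 := H 1
  have H2 := H 2
  have H3 := H 3
  have H4 := H 4
  have H5 := H 5
  have c0 : ∀ n : ℕ, ((n + 0).choose 0 : ℂ) = 1 := by simp
  have c1 : ∀ n : ℕ, ((n + 1).choose 1 : ℂ) = n + 1 := by simp
  have c2 : ∀ n : ℕ, ((n + 2).choose 2 : ℂ) = (n + 1) * (n + 2) / 2 := by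
    intro n
    have := choose_cast n 1
    rw [c1] at this; rw [this]; push_cast; ring
  have c3 : ∀ n : ℕ, ((n + 3).choose 3 : ℂ) = (n + 1) * (n + 2) * (n + 3) / 6 := by
    intro n
    have := choose_cast n 2
    rw [c2] at this; rw [this]; push_cast; ring
  have c4 : ∀ n : ℕ, ((n + 4).choose 4 : ℂ) = (n + 1) * (n + 2) * (n + 3) * (n + 4) / 24 := by
    intro n
    have := choose_cast n 3
    rw [c3] at this; rw [this]; push_cast; ring
  have c5 : ∀ n : ℕ, ((n + 5).choose 5 : ℂ) =
      (n + 1) * (n + 2) * (n + 3) * (n + 4) * (n + 5) / 120 := by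
    intro n
    have := choose_cast n 4
    rw [c4] at this; rw [this]; push_cast; ring
  simp only [c0, c1, c2, c3, c4, c5] at H0 H1 H2 H3 H4 H5
  refine ⟨?_, ?_, ?_⟩
  · have := H1.sub H0
    rw [← this.tsum_eq.symm.trans (tsum_congr fun n => ?_)]
    · field_simp; ring
    · ring
  · have := (((H3.mul_left 6).sub (H2.mul_left 12)).add (H1.mul_left 7)).sub H0
    rw [← this.tsum_eq.symm.trans (tsum_congr fun n => ?_)]
    · field_simp; ring
    · ring
  · have := (((((H5.mul_left 120).sub (H4.mul_left 360)).add (H3.mul_left 390)).sub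
      (H2.mul_left 180)).add (H1.mul_left 31)).sub H0
    rw [← this.tsum_eq.symm.trans (tsum_congr fun n => ?_)]
    · field_simp; ring
    · ring

lemma rowS_pos (k : ℕ) (hk : 1 ≤ k) (τ : ℂ) (hτ : 0 < τ.im) (m : ℕ) (hm : 0 < m)
    (he : Even (k + 1)) :
    rowS (k + 1) τ m = (2 * π * Complex.I / τ) ^ (k + 1) / (k.factorial : ℂ) *
      ∑' n : ℕ, (n : ℂ) ^ k * (Complex.exp (2 * π * Complex.I * (-1 / τ)) ^ m) ^ n := by
  have hτ0 : τ ≠ 0 := by rintro rfl; simp at hτ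
  have him : 0 < (-(m : ℂ) / τ).im := by
    have hn : 0 < Complex.normSq τ := Complex.normSq_pos.mpr hτ0
    have : (-(m : ℂ) / τ).im = m * τ.im / Complex.normSq τ := by
      simp [Complex.div_im, neg_div]
    rw [this]
    positivity
  have h := EisensteinSeries.qExpansion_identity hk ⟨-(m : ℂ) / τ, him⟩
  simp only at h
  have e1 : rowS (k + 1) τ m =
      (1 / τ) ^ (k + 1) * ∑' n : ℤ, 1 / (-(m : ℂ) / τ + n) ^ (k + 1) := by
    unfold rowS
    rw [← tsum_mul_left, ← (Equiv.neg ℤ).tsum_eq]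
    refine tsum_congr fun n => ?_
    rw [← he.neg_pow, one_div_pow, one_div_mul_one_div, ← mul_pow]
    congr 2
    simp only [Equiv.neg_apply]
    push_cast
    field_simp
    ring
  rw [e1, h]
  have e2 : Complex.exp (2 * π * Complex.I * (-(m : ℂ) / τ)) =
      Complex.exp (2 * π * Complex.I * (-1 / τ)) ^ m := by
    rw [← Complex.exp_nat_mul]
    congr 1
    ring
  rw [e2, ← mul_assoc]
  congr 1
  rw [show (-2 * π * Complex.I : ℂ) = -(2 * π * Complex.I) by ring, he.neg_pow]
  ring

lemma norm_q_lt (τ : ℂ) (hτ : 0 < τ.im) :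
    ‖Complex.exp (2 * π * Complex.I * (-1 / τ))‖ < 1 := by
  have hτ0 : τ ≠ 0 := by rintro rfl; simp at hτ
  have him : 0 < (-1 / τ).im := by
    have hn : 0 < Complex.normSq τ := Complex.normSq_pos.mpr hτ0
    have : (-1 / τ).im = τ.im / Complex.normSq τ := by
      simp [Complex.div_im, neg_div]
    rw [this]
    positivity
  exact UpperHalfPlane.norm_exp_two_pi_I_lt_one ⟨-1 / τ, him⟩

/-- closed forms -/
lemma rowS_closed (τ : ℂ) (hτ : 0 < τ.im) (m : ℕ) (hm : 0 < m) :
    rowS 4 τ m = rowS 2 τ m ^ 2 - 2 / 3 * (π / τ) ^ 2 * rowS 2 τ m ∧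
    rowS 6 τ m = rowS 2 τ m ^ 3 - (π / τ) ^ 2 * rowS 2 τ m ^ 2
      + 2 / 15 * (π / τ) ^ 4 * rowS 2 τ m ∧
    rowS 2 τ m = (2 * π * Complex.I / τ) ^ 2 * 
      (Complex.exp (2 * π * Complex.I * (-1 / τ)) ^ m /
        (1 - Complex.exp (2 * π * Complex.I * (-1 / τ)) ^ m) ^ 2) := by
  have hτ0 : τ ≠ 0 := by rintro rfl; simp at hτ
  have hq := norm_q_lt τ hτ
  have a2 := rowS_pos 1 (by norm_num) τ hτ m hm (by decide)
  have a4 := rowS_pos 3 (by norm_num) τ hτ m hm (by decide)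
  have a6 := rowS_pos 5 (by norm_num) τ hτ m hm (by decide)
  set q := Complex.exp (2 * π * Complex.I * (-1 / τ)) ^ m with hqdef
  have hq' : ‖q‖ < 1 := by
    rw [hqdef, norm_pow]
    exact pow_lt_one₀ (norm_nonneg _) hq hm.ne'
  have h1 : 1 - q ≠ 0 := by
    intro h
    rw [← sub_eq_zero.mp h] at hq'
    simp at hq'
  obtain ⟨t1, t3, t5⟩ := tsum_pows q hq'
  rw [t1] at a2
  rw [t3] at a4
  rw [t5] at a6
  norm_num [Nat.factorial] at a2 a4 a6
  have hI2 : Complex.I ^ 2 = -1 := Complex.I_sq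
  have p2 : (2 * π * Complex.I / τ) ^ 2 = -4 * (π / τ) ^ 2 := by
    rw [div_pow, mul_pow, hI2]; ring
  have p4 : (2 * π * Complex.I / τ) ^ 4 = 16 * (π / τ) ^ 4 := by
    rw [show (4 : ℕ) = 2 * 2 from rfl, pow_mul, p2]; ring
  have p6 : (2 * π * Complex.I / τ) ^ 6 = -64 * (π / τ) ^ 6 := by
    rw [show (6 : ℕ) = 2 * 3 from rfl, pow_mul, p2]; ring
  rw [p2] at a2
  rw [p4] at a4
  rw [p6] at a6
  refine ⟨?_, ?_, ?_⟩
  · rw [a4, a2]; field_simp; ring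
  · rw [a6, a2]; field_simp; ring
  · rw [a2, p2]

lemma summable_int_of_even (f : ℤ → ℂ) (hf : ∀ m, f (-m) = f m) (C r : ℝ)
    (hr0 : 0 ≤ r) (hr : r < 1) (h : ∀ m : ℕ, 0 < m → ‖f m‖ ≤ C * r ^ m) : Summable f := by
  have key : Summable fun n : ℕ => f n := by
    refine Summable.of_norm_bounded_eventually_nat
      ((summable_geometric_of_lt_one hr0 hr).mul_left C) ?_
    filter_upwards [Filter.eventually_gt_atTop 0] with m hm using h m hm
  refine Summable.of_nat_of_neg key ?_
  simpa only [hf] using key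

lemma exists_bound (τ : ℂ) (hτ : 0 < τ.im) : ∃ C r : ℝ, 0 ≤ C ∧ 0 ≤ r ∧ r < 1 ∧
    ∀ m : ℕ, 0 < m → ‖rowS 2 τ m‖ ≤ C * r ^ m := by
  have hq := norm_q_lt τ hτ
  refine ⟨‖(2 * π * Complex.I / τ) ^ 2‖ / 
    (1 - ‖Complex.exp (2 * π * Complex.I * (-1 / τ))‖) ^ 2, _, by positivity, norm_nonneg _, hq, ?_⟩
  intro m hm
  rw [(rowS_closed τ hτ m hm).2.2]
  set q := Complex.exp (2 * π * Complex.I * (-1 / τ))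
  rw [norm_mul, norm_div, norm_pow q, norm_pow (1 - q ^ m)]
  have h1 : 0 < 1 - ‖q‖ := by linarith
  have h2 : 1 - ‖q‖ ≤ ‖1 - q ^ m‖ := by
    have := norm_sub_norm_le (1 : ℂ) (q ^ m)
    rw [norm_one, norm_pow] at this
    have h3 : ‖q‖ ^ m ≤ ‖q‖ := pow_le_of_le_one (norm_nonneg _) hq.le hm.ne'
    linarith
  calc ‖(2 * π * Complex.I / τ) ^ 2‖ * (‖q‖ ^ m / ‖1 - q ^ m‖ ^ 2)
      ≤ ‖(2 * π * Complex.I / τ) ^ 2‖ * (‖q‖ ^ m / (1 - ‖q‖) ^ 2) := by gcongr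
    _ = _ := by ring

lemma summable_rowS_pow (τ : ℂ) (hτ : 0 < τ.im) (j : ℕ) (hj : j ≠ 0) :
    Summable fun m : ℤ => rowS 2 τ m ^ j := by
  obtain ⟨C, r, hC, hr0, hr, h⟩ := exists_bound τ hτ
  refine summable_int_of_even _ (fun m => by rw [rowS_neg 2 (by decide)]) (C ^ j) r hr0 hr ?_
  intro m hm
  rw [norm_pow]
  calc ‖rowS 2 τ m‖ ^ j ≤ (C * r ^ m) ^ j := by gcongr; exact h m hm
    _ = C ^ j * (r ^ m) ^ j := mul_pow _ _ _
    _ ≤ C ^ j * r ^ m := by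
      gcongr
      exact pow_le_of_le_one (by positivity) (pow_le_one₀ hr0 hr.le) hj

lemma rowS_closed_int (τ : ℂ) (hτ : 0 < τ.im) (m : ℤ) (hm : m ≠ 0) :
    rowS 4 τ m = rowS 2 τ m ^ 2 - 2 / 3 * (π / τ) ^ 2 * rowS 2 τ m ∧
    rowS 6 τ m = rowS 2 τ m ^ 3 - (π / τ) ^ 2 * rowS 2 τ m ^ 2
      + 2 / 15 * (π / τ) ^ 4 * rowS 2 τ m := by
  obtain ⟨n, rfl | rfl⟩ := m.eq_nat_or_neg
  · have := rowS_closed τ hτ n (by omega)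
    exact ⟨this.1, this.2.1⟩
  · have := rowS_closed τ hτ n (by omega)
    rw [rowS_neg 2 (by decide), rowS_neg 4 (by decide), rowS_neg 6 (by decide)]
    exact ⟨this.1, this.2.1⟩

lemma zeta_six : riemannZeta 6 = (π : ℂ) ^ 6 / 945 := by
  have h := riemannZeta_two_mul_nat (k := 3) (by norm_num)
  have b5 : bernoulli' 5 = 0 := by
    rw [bernoulli'_def]
    norm_num [Finset.sum_range_succ, bernoulli'_two, bernoulli'_three, bernoulli'_four,
      Nat.choose]
  have b6 : bernoulli 6 = 1 / 42 := by
    rw [bernoulli_eq_bernoulli'_of_ne_one (by norm_num), bernoulli'_def]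
    norm_num [Finset.sum_range_succ, bernoulli'_two, bernoulli'_three, bernoulli'_four, b5,
      Nat.choose]
  norm_num [b6, Nat.factorial] at h
  rw [h]; ring

lemma rowS_zero (k : ℕ) (hk : 2 ≤ k) (he : Even k) (τ : ℂ) :
    rowS k τ 0 = 2 * riemannZeta k / τ ^ k := by
  rw [two_mul_riemannZeta_eq_tsum_int_inv_pow_of_even hk he, div_eq_mul_inv, ← tsum_mul_right]
  unfold rowS
  refine tsum_congr fun n => ?_
  simp [mul_pow, mul_comm]

lemma summable_of_ne_zero (f g : ℤ → ℂ) (hg : Summable g) (h : ∀ m, m ≠ 0 → f m = g m) :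
    Summable f := by
  refine (hg.add (hasSum_ite_eq (0 : ℤ) (f 0 - g 0)).summable).congr fun m => ?_
  by_cases hm : m = 0
  · simp [hm]
  · simp [hm, h m hm]

theorem tildeG_two_two_two (τ : ℂ) (hτ : 0 < τ.im) :
    tildeG3 1 1 1 τ = G 6 τ + (π : ℂ) ^ 2 / τ ^ 2 * G 4 τ +
      8 * (π : ℂ) ^ 4 / (15 * τ ^ 4) * G 2 τ - 52 * (π : ℂ) ^ 6 / (315 * τ ^ 6) := by
  have hτ0 : τ ≠ 0 := by rintro rfl; simp at hτ
  rw [tildeG3_eq_rowS, G_eq_rowS 6 (by norm_num), G_eq_rowS 4 (by norm_num),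
    G_eq_rowS 2 (by norm_num)]
  have s1 : Summable fun m : ℤ => rowS 2 τ m := by
    simpa using summable_rowS_pow τ hτ 1 (by norm_num)
  have s2 := summable_rowS_pow τ hτ 2 (by norm_num)
  have s3 := summable_rowS_pow τ hτ 3 (by norm_num)
  have s4 : Summable fun m : ℤ => rowS 4 τ m :=
    summable_of_ne_zero _ _ (s2.sub (s1.mul_left (2 / 3 * (π / τ) ^ 2)))
      fun m hm => (rowS_closed_int τ hτ m hm).1
  have s6 : Summable fun m : ℤ => rowS 6 τ m :=
    summable_of_ne_zero _ _ ((s3.sub (s2.mul_left ((π / τ) ^ 2))).add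
      (s1.mul_left (2 / 15 * (π / τ) ^ 4)))
      fun m hm => (rowS_closed_int τ hτ m hm).2
  have key := ((s6.hasSum.add (s4.hasSum.mul_left ((π : ℂ) ^ 2 / τ ^ 2))).add
    (s1.hasSum.mul_left (8 * (π : ℂ) ^ 4 / (15 * τ ^ 4)))).sub
    (hasSum_ite_eq (0 : ℤ) (52 * (π : ℂ) ^ 6 / (315 * τ ^ 6)))
  rw [← key.tsum_eq]
  refine tsum_congr fun m => ?_
  by_cases hm : m = 0
  · subst hm
    rw [rowS_zero 2 (by norm_num) (by decide), rowS_zero 4 (by norm_num) (by decide),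
      rowS_zero 6 (by norm_num) (by decide)]
    push_cast
    rw [zeta_six, riemannZeta_two, riemannZeta_four]
    field_simp
    ring
  · obtain ⟨h4, h6⟩ := rowS_closed_int τ hτ m hm
    rw [if_neg hm, h4, h6]
    field_simp
    ring
end

section
/- For every positive integer ν and every nonzero real x, 1/(sinh(πx))^{2ν} = (2^{2ν}/(2ν-1)!) Σ_{j=1}^{ν} α(ν, 2j-1) ((2j-1)!/(2πi)^{2j}) Σ_{l∈ℤ} 1/(x·i + l)^{2j}, where the coefficients α(n,k) are defined by X·Π_{l=1}^{n-1}(X-l)(X+l) = Σ_{k=0}^{2n-1} α(n,k) X^k. -/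
open Real Complex

/-- The coefficients `α(n,k)` defined by
`X · Π_{l=1}^{n-1} (X - l)(X + l) = Σ_{k=0}^{2n-1} α(n,k) X^k`. -/
noncomputable def alph (n k : ℕ) : ℤ :=
  (Polynomial.X *
    ∏ l ∈ Finset.range (n - 1),
      ((Polynomial.X - Polynomial.C ((l : ℤ) + 1)) *
       (Polynomial.X + Polynomial.C ((l : ℤ) + 1)))).coeff k

/-- auxiliary polynomial -/
noncomputable def auxQ (m : ℕ) : Polynomial ℤ :=
  ∏ l ∈ Finset.range m, (Polynomial.X - Polynomial.C (((l : ℤ) + 1) ^ 2))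

lemma auxQ_monic (m : ℕ) : (auxQ m).Monic :=
  Polynomial.monic_prod_of_monic _ _ (fun _ _ => Polynomial.monic_X_sub_C _)

lemma auxQ_natDegree (m : ℕ) : (auxQ m).natDegree = m := by
  unfold auxQ
  rw [Polynomial.natDegree_prod_of_monic _ _ (fun _ _ => Polynomial.monic_X_sub_C _)]
  simp only [Polynomial.natDegree_X_sub_C]
  simp

lemma alph_eq (m j : ℕ) : alph (m + 1) (2 * j + 1) = (auxQ m).coeff j := by
  unfold alph
  have h : (∏ l ∈ Finset.range (m + 1 - 1),
      ((Polynomial.X - Polynomial.C ((l : ℤ) + 1)) *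
       (Polynomial.X + Polynomial.C ((l : ℤ) + 1)))) = Polynomial.expand ℤ 2 (auxQ m) := by
    unfold auxQ
    rw [map_prod, Nat.add_sub_cancel]
    refine Finset.prod_congr rfl fun l _ => ?_
    rw [map_sub, Polynomial.expand_X, Polynomial.expand_C, Polynomial.C_pow]
    ring
  rw [h, Polynomial.coeff_X_mul, mul_comm 2 j, Polynomial.coeff_expand_mul (by norm_num)]

/-- the value of the polynomial at an integer -/
noncomputable def auxP (m : ℕ) (n : ℕ) : ℤ :=
  n * ∏ l ∈ Finset.range m, ((n : ℤ) ^ 2 - ((l : ℤ) + 1) ^ 2)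

lemma auxP_sum (m n : ℕ) :
    ∑ j ∈ Finset.range (m + 1), alph (m + 1) (2 * j + 1) * (n : ℤ) ^ (2 * j + 1) = auxP m n := by
  have h := Polynomial.eval_eq_sum_range (p := auxQ m) ((n : ℤ) ^ 2)
  rw [auxQ_natDegree] at h
  have h2 : (auxQ m).eval ((n : ℤ) ^ 2) =
      ∏ l ∈ Finset.range m, ((n : ℤ) ^ 2 - ((l : ℤ) + 1) ^ 2) := by
    unfold auxQ
    rw [Polynomial.eval_prod]
    refine Finset.prod_congr rfl fun l _ => ?_
    rw [Polynomial.eval_sub, Polynomial.eval_X, Polynomial.eval_C]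
  unfold auxP
  rw [← h2, h, Finset.mul_sum]
  refine Finset.sum_congr rfl fun j _ => ?_
  rw [alph_eq]
  ring

lemma auxP_zero (m n : ℕ) (h : n < m + 1) : auxP m n = 0 := by
  unfold auxP
  rcases Nat.eq_zero_or_pos n with h0 | h0
  · simp [h0]
  · rw [Finset.prod_eq_zero (i := n - 1) (by simp; omega), mul_zero]
    have : ((n - 1 : ℕ) : ℤ) + 1 = n := by omega
    rw [this]; ring

lemma auxP_fact (m k : ℕ) :
    auxP m (k + (m + 1)) * (k.factorial : ℤ) = ((k + (2 * m + 1)).factorial : ℤ) := by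
  induction m generalizing k with
  | zero => simp [auxP, Nat.factorial_succ]
  | succ m ih =>
    have h := ih (k + 1)
    have e1 : k + (2 * (m + 1) + 1) = (k + 1 + (2 * m + 1)) + 1 := by ring
    rw [e1, Nat.factorial_succ, Nat.cast_mul, ← h, Nat.factorial_succ k]
    have e2 : k + 1 + (m + 1) = k + (m + 1 + 1) := by ring
    rw [e2]
    unfold auxP
    rw [Finset.prod_range_succ]
    push_cast
    ring

lemma auxP_choose (m k : ℕ) :
    auxP m (k + (m + 1)) = ((2 * m + 1).factorial : ℤ) * ((k + (2 * m + 1)).choose (2 * m + 1) : ℤ) := by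
  have h := auxP_fact m k
  have h2 := Nat.add_choose_mul_factorial_mul_factorial k (2 * m + 1)
  have h3 : (k.factorial : ℤ) ≠ 0 := by exact_mod_cast k.factorial_ne_zero
  apply mul_right_cancel₀ h3
  rw [h, ← h2]
  push_cast
  ring

lemma auxP_hasSum (m : ℕ) (q : ℂ) (hq : ‖q‖ < 1) :
    HasSum (fun n : ℕ => (auxP m n : ℂ) * q ^ n)
      (((2 * m + 1).factorial : ℂ) * (q ^ (m + 1) / (1 - q) ^ (2 * (m + 1)))) := by
  have h := (hasSum_choose_mul_geometric_of_norm_lt_one (2 * m + 1) hq).mul_left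
    (((2 * m + 1).factorial : ℂ) * q ^ (m + 1))
  have h0 : ∑ n ∈ Finset.range (m + 1), (auxP m n : ℂ) * q ^ n = 0 := by
    refine Finset.sum_eq_zero fun n hn => ?_
    rw [auxP_zero m n (Finset.mem_range.1 hn)]; simp
  have h1 := (hasSum_nat_add_iff (f := fun n : ℕ => (auxP m n : ℂ) * q ^ n) (m + 1)
    (g := ((2 * m + 1).factorial : ℂ) * (q ^ (m + 1) / (1 - q) ^ (2 * (m + 1))))).1
  rw [h0, add_zero] at h1
  apply h1
  convert! h using 1
  · funext k
    rw [auxP_choose]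
    push_cast
    ring
  · rw [show 2 * m + 1 + 1 = 2 * (m + 1) by ring]
    ring

lemma key_pos (m : ℕ) (x : ℝ) (hx : 0 < x) :
    (1 / (Real.sinh (π * x)) ^ (2 * (m + 1)) : ℂ) =
      2 ^ (2 * (m + 1)) / (Nat.factorial (2 * m + 1) : ℂ) *
        ∑ j ∈ Finset.range (m + 1),
          (alph (m + 1) (2 * j + 1) : ℂ) *
            ((Nat.factorial (2 * j + 1) : ℂ) / (2 * (π : ℂ) * Complex.I) ^ (2 * j + 2)) *
            ∑' l : ℤ, 1 / ((x : ℂ) * Complex.I + l) ^ (2 * j + 2) := by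
  let z : UpperHalfPlane := ⟨(x : ℂ) * Complex.I, by simpa using hx⟩
  have hz : (z : ℂ) = (x : ℂ) * Complex.I := rfl
  let q : ℂ := (Real.exp (-(2 * π * x)) : ℝ)
  have hqz : cexp (2 * π * Complex.I * z) = q := by
    simp only [q]
    rw [hz, Complex.ofReal_exp]
    congr 1
    push_cast
    linear_combination (2 * (π : ℂ) * x) * Complex.I_mul_I
  have hqn : ‖q‖ < 1 := by
    simp only [q]
    rw [Complex.norm_real, Real.norm_eq_abs, abs_of_pos (Real.exp_pos _), Real.exp_lt_one_iff]
    have := Real.pi_pos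
    nlinarith [mul_pos this hx]
  have hI : (2 * (π : ℂ) * Complex.I) ≠ 0 := Complex.two_pi_I_ne_zero
  have hterm : ∀ j : ℕ, ((Nat.factorial (2 * j + 1) : ℂ) / (2 * (π : ℂ) * Complex.I) ^ (2 * j + 2)) *
      ∑' l : ℤ, 1 / ((x : ℂ) * Complex.I + l) ^ (2 * j + 2) =
      ∑' n : ℕ, (n : ℂ) ^ (2 * j + 1) * q ^ n := by
    intro j
    have h := EisensteinSeries.qExpansion_identity (k := 2 * j + 1) (by omega) z
    rw [hqz, hz] at h
    rw [h]
    have h2 : (-2 * (π : ℂ) * Complex.I) ^ (2 * j + 1 + 1) = (2 * (π : ℂ) * Complex.I) ^ (2 * j + 2) := by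
      rw [show -2 * (π : ℂ) * Complex.I = -(2 * (π : ℂ) * Complex.I) by ring]
      exact Even.neg_pow ⟨j + 1, by ring⟩ _
    rw [h2, ← mul_assoc]
    have h3 : ((2 * j + 1).factorial : ℂ) ≠ 0 := by exact_mod_cast (2 * j + 1).factorial_ne_zero
    rw [div_mul_div_cancel₀ (pow_ne_zero _ hI), div_self h3, one_mul]
  have hs : ∑ j ∈ Finset.range (m + 1),
          (alph (m + 1) (2 * j + 1) : ℂ) *
            ((Nat.factorial (2 * j + 1) : ℂ) / (2 * (π : ℂ) * Complex.I) ^ (2 * j + 2)) *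
            ∑' l : ℤ, 1 / ((x : ℂ) * Complex.I + l) ^ (2 * j + 2) =
        ((2 * m + 1).factorial : ℂ) * (q ^ (m + 1) / (1 - q) ^ (2 * (m + 1))) := by
    simp_rw [mul_assoc (alph _ _ : ℂ), hterm]
    have h4 : HasSum (fun n : ℕ => ∑ j ∈ Finset.range (m + 1),
        (alph (m + 1) (2 * j + 1) : ℂ) * ((n : ℂ) ^ (2 * j + 1) * q ^ n))
        (∑ j ∈ Finset.range (m + 1),
        (alph (m + 1) (2 * j + 1) : ℂ) * ∑' n : ℕ, (n : ℂ) ^ (2 * j + 1) * q ^ n) :=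
      hasSum_sum fun j _ =>
        (summable_pow_mul_geometric_of_norm_lt_one (2 * j + 1) hqn).hasSum.mul_left _
    refine h4.unique ?_
    convert! auxP_hasSum m q hqn using 1
    funext n
    rw [← auxP_sum]
    push_cast
    rw [Finset.sum_mul]
    simp_rw [mul_assoc]
  rw [hs]
  have h5 : ((2 * m + 1).factorial : ℂ) ≠ 0 := by exact_mod_cast (2 * m + 1).factorial_ne_zero
  let e : ℝ := Real.exp (-(π * x))
  have he : 0 < e := Real.exp_pos _
  have hqe : Real.exp (-(2 * π * x)) = e ^ 2 := by
    simp only [e]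
    rw [← Real.exp_nat_mul]; congr 1; push_cast; ring
  have he1 : e < 1 := by
    simp only [e]
    rw [Real.exp_lt_one_iff]
    have := mul_pos Real.pi_pos hx
    linarith
  have hsinh : Real.sinh (π * x) = (1 - e ^ 2) / (2 * e) := by
    rw [Real.sinh_eq]
    have : Real.exp (π * x) = e⁻¹ := by simp only [e]; rw [Real.exp_neg, inv_inv]
    rw [this]
    change (e⁻¹ - e) / 2 = _
    field_simp
  have hne : (1 - e ^ 2) ≠ 0 := by nlinarith
  have hneC : (1 - (e : ℂ) ^ 2) ≠ 0 := by exact_mod_cast hne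
  have heC : (e : ℂ) ≠ 0 := by exact_mod_cast he.ne'
  have hqC : q = (e : ℂ) ^ 2 := by simp only [q]; rw [hqe]; push_cast; rfl
  rw [hqC, hsinh]
  push_cast
  rw [div_pow, mul_pow]
  field_simp
  rw [pow_mul]

theorem inv_sinh_pow_eq (ν : ℕ) (hν : 1 ≤ ν) (x : ℝ) (hx : x ≠ 0) :
    (1 / (Real.sinh (π * x)) ^ (2 * ν) : ℂ) =
      2 ^ (2 * ν) / (Nat.factorial (2 * ν - 1) : ℂ) *
        ∑ j ∈ Finset.Icc 1 ν,
          (alph ν (2 * j - 1) : ℂ) *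
            ((Nat.factorial (2 * j - 1) : ℂ) / (2 * (π : ℂ) * Complex.I) ^ (2 * j)) *
            ∑' l : ℤ, 1 / ((x : ℂ) * Complex.I + l) ^ (2 * j) := by
  obtain ⟨m, rfl⟩ : ∃ m, ν = m + 1 := ⟨ν - 1, by omega⟩
  have hre : ∀ f : ℕ → ℂ, ∑ j ∈ Finset.Icc 1 (m + 1), f j = ∑ j ∈ Finset.range (m + 1), f (j + 1) := by
    intro f
    rw [Finset.range_eq_Ico, Finset.sum_Ico_add' f 0 (m + 1) 1]
    rfl
  rw [hre]
  have e1 : ∀ j : ℕ, 2 * (j + 1) - 1 = 2 * j + 1 := fun j => by omega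
  have e2 : ∀ j : ℕ, 2 * (j + 1) = 2 * j + 2 := fun j => by omega
  simp_rw [e1]
  rcases lt_or_gt_of_ne hx with h | h
  · have hk := key_pos m (-x) (by linarith)
    have hflip : ∀ j : ℕ, ∑' l : ℤ, 1 / (((-x : ℝ) : ℂ) * Complex.I + l) ^ (2 * j + 2) =
        ∑' l : ℤ, 1 / ((x : ℂ) * Complex.I + l) ^ (2 * j + 2) := by
      intro j
      rw [← (Equiv.neg ℤ).tsum_eq]
      refine tsum_congr fun l => ?_
      congr 1
      rw [← Even.neg_pow (⟨j + 1, by ring⟩ : Even (2 * j + 2))]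
      congr 1
      simp
      ring
    simp_rw [hflip] at hk
    rw [mul_neg, Real.sinh_neg, Complex.ofReal_neg, Even.neg_pow (even_two_mul _)] at hk
    exact hk
  · exact key_pos m x h
end
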